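/- arXiv:2303.15165 — 3 statements merged into one kernel-verified Lean document; each statement's English description precedes it below -/
import Mathlib

section
/- Nag–Sullivan boundedness theorem: Let φ̃ : ℝ → ℝ be an increasing homeomorphism with φ̃(x+1) = φ̃(x) + 1, inducing an orientation-preserving homeomorphism φ of the circle. Then the following are equivalent: (i) φ is quasisymmetric; (ii) there exists a constant C > 0 such that for every real-valued trigonometric polynomial f of period 1 one has ‖f ∘ φ̃‖_{1/2} ≤ C ‖f‖_{1/2}. That is, the composition operator V_φ : f ↦ f∘φ − ∫₀¹ f∘φ maps the Hilbert space H^{1/2}(S¹, ℝ)/ℝ boundedly into itself if and only if φ is quasisymmetric. -/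
open Complex MeasureTheory

/-- `f : ℝ → ℝ` is the lift of an orientation-preserving homeomorphism of the circle:
an increasing homeomorphism of `ℝ` commuting with `x ↦ x + 1`. -/
def IsCircleLift (f : ℝ → ℝ) : Prop :=
  StrictMono f ∧ Function.Surjective f ∧ ∀ x, f (x + 1) = f x + 1

/-- Quasisymmetry of the circle homeomorphism with lift `f`, with constant `M`. -/
def QSConst (f : ℝ → ℝ) (M : ℝ) : Prop :=
  0 < M ∧ ∀ x t : ℝ, 0 < t → t ≤ 1 / 2 →
    1 / M ≤ (f (x + t) - f x) / (f x - f (x - t)) ∧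
      (f (x + t) - f x) / (f x - f (x - t)) ≤ M

/-- The `n`-th Fourier coefficient `f̂(n) = ∫₀¹ f(x) e^{−2πinx} dx` of a `1`-periodic
function `f : ℝ → ℂ`. -/
noncomputable def fourierCoeff1 (f : ℝ → ℂ) (n : ℤ) : ℂ :=
  ∫ x in (0 : ℝ)..1, f x * Complex.exp (-(2 * Real.pi * Complex.I * n * x))

/-- The squared `H^{1/2}`-seminorm `‖f‖_{1/2}² = Σ_{n∈ℤ} |n| |f̂(n)|² ∈ [0,∞]` of a
`1`-periodic real-valued function `f`. -/
noncomputable def H12seminormSq (f : ℝ → ℝ) : ENNReal :=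
  ∑' n : ℤ, (n.natAbs : ENNReal) * (‖fourierCoeff1 (fun x => (f x : ℂ)) n‖₊ : ENNReal) ^ 2

/-- `f : ℝ → ℝ` is a real trigonometric polynomial of period `1`: a finite sum
`Σ cₙ e^{2πinx}` with `c₋ₙ = conj cₙ`. -/
def IsRealTrigPoly (f : ℝ → ℝ) : Prop :=
  ∃ N : ℤ, ∃ c : ℤ → ℂ, (∀ n : ℤ, N < |n| → c n = 0) ∧
    (∀ n : ℤ, c (-n) = (starRingEnd ℂ) (c n)) ∧
    ∀ x : ℝ, (f x : ℂ) =
      ∑ n ∈ Finset.Icc (-N) N, c n * Complex.exp (2 * Real.pi * Complex.I * n * x)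


/-! ### Part 1: the Douglas formula -/

open Set

noncomputable def De (g : ℝ → ℝ) : ENNReal :=
  ∫⁻ t in Ioc (0:ℝ) 1, ∫⁻ x in Ioc (0:ℝ) 1,
    ENNReal.ofReal ((g (x + t) - g x) ^ 2 / Real.sin (Real.pi * t) ^ 2)

lemma coeffOn_eq (h : ℝ → ℂ) (n : ℤ) :
    fourierCoeffOn (zero_lt_one' ℝ) h n = fourierCoeff1 h n := by
  rw [fourierCoeffOn_eq_integral, fourierCoeff1]
  simp only [sub_zero, div_one, one_smul]
  apply intervalIntegral.integral_congr
  intro x _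
  simp only [fourier_apply, smul_eq_mul]
  rw [mul_comm]
  congr 1
  have := fourier_coe_apply (T := (1 - 0 : ℝ)) (n := -n) (x := x)
  rw [fourier_apply] at this
  rw [this]
  congr 1
  push_cast
  ring

lemma parseval1 (h : ℝ → ℂ) (hc : Continuous h) :
    HasSum (fun n : ℤ => ‖fourierCoeff1 h n‖ ^ 2) (∫ x in (0:ℝ)..1, ‖h x‖ ^ 2) := by
  have hL2 : MemLp h 2 (volume.restrict (Ioc (0:ℝ) 1)) := by
    have : MemLp h 2 (volume.restrict (Icc (0:ℝ) 1)) := by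
      obtain ⟨C, hC⟩ := isCompact_Icc.exists_bound_of_continuousOn (hc.continuousOn (s := Icc (0:ℝ) 1))
      exact MemLp.of_bound hc.aestronglyMeasurable C
        ((ae_restrict_iff' measurableSet_Icc).2 (Filter.Eventually.of_forall hC))
    exact this.mono_measure (Measure.restrict_mono Ioc_subset_Icc_self le_rfl)
  have := hasSum_sq_fourierCoeffOn (zero_lt_one' ℝ) hL2
  simpa [coeffOn_eq] using this

lemma coeff_shift (h : ℝ → ℂ) (hc : Continuous h) (hp : Function.Periodic h 1) (t : ℝ) (n : ℤ) :
    fourierCoeff1 (fun x => h (x + t) - h x) n =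
      (Complex.exp (Complex.I * ((2 * Real.pi * n * t : ℝ) : ℂ)) - 1) * fourierCoeff1 h n := by
  set k : ℝ → ℂ := fun x => h x * Complex.exp (-(2 * Real.pi * Complex.I * n * x)) with hk
  have hkc : Continuous k := by fun_prop
  have hkp : Function.Periodic k 1 := by
    intro x
    simp only [hk]
    rw [hp x]
    congr 1
    have : -(2 * Real.pi * Complex.I * n * ((x + 1 : ℝ) : ℂ)) =
      -(2 * Real.pi * Complex.I * n * x) + ((-n : ℤ) : ℂ) * (2 * Real.pi * Complex.I) := by
      push_cast; ring
    rw [this, Complex.exp_add, Complex.exp_int_mul_two_pi_mul_I, mul_one]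
  have h1 : ∀ x : ℝ, (h (x + t) - h x) * Complex.exp (-(2 * Real.pi * Complex.I * n * x)) =
      Complex.exp (Complex.I * ((2 * Real.pi * n * t : ℝ) : ℂ)) * k (x + t) - k x := by
    intro x
    simp only [hk]
    rw [sub_mul, mul_left_comm, ← Complex.exp_add]
    congr 3
    push_cast; ring
  have h2 : ∫ x in (0:ℝ)..1, k (x + t) = ∫ x in (0:ℝ)..1, k x := by
    rw [intervalIntegral.integral_comp_add_right, zero_add, add_comm 1 t,
      hkp.intervalIntegral_add_eq t 0, zero_add]
  unfold fourierCoeff1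
  simp_rw [h1]
  rw [intervalIntegral.integral_sub, intervalIntegral.integral_const_mul, h2]
  · ring
  · exact (by fun_prop : Continuous _).intervalIntegrable _ _
  · exact hkc.intervalIntegrable _ _

lemma inner_eq (g : ℝ → ℝ) (hc : Continuous g) (hp : Function.Periodic g 1) (t : ℝ) :
    ∫⁻ x in Ioc (0:ℝ) 1, ENNReal.ofReal ((g (x + t) - g x) ^ 2 / Real.sin (Real.pi * t) ^ 2) =
      ∑' n : ℤ, ENNReal.ofReal (Real.sin (Real.pi * n * t) ^ 2 / Real.sin (Real.pi * t) ^ 2) *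
        (4 * ENNReal.ofReal (‖fourierCoeff1 (fun x => (g x : ℂ)) n‖ ^ 2)) := by
  set h : ℝ → ℂ := fun x => (g x : ℂ) with hh
  have hhc : Continuous h := by fun_prop
  have hhp : Function.Periodic h 1 := fun x => by simp [hh, hp x]
  have hP := parseval1 (fun x => h (x + t) - h x) (by fun_prop)
  have hn : ∀ n : ℤ, ‖fourierCoeff1 (fun x => h (x + t) - h x) n‖ ^ 2 =
      4 * Real.sin (Real.pi * n * t) ^ 2 * ‖fourierCoeff1 h n‖ ^ 2 := by
    intro n
    rw [coeff_shift h hhc hhp, norm_mul, Complex.norm_exp_I_mul_ofReal_sub_one, mul_pow]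
    rw [Real.norm_eq_abs, sq_abs, mul_pow,
      show (2 * Real.pi * n * t / 2 : ℝ) = Real.pi * n * t by ring]
    norm_num
  simp_rw [hn] at hP
  have hP2 := hP.div_const (Real.sin (Real.pi * t) ^ 2)
  have hl : ∫⁻ x in Ioc (0:ℝ) 1, ENNReal.ofReal ((g (x + t) - g x) ^ 2 / Real.sin (Real.pi * t) ^ 2)
      = ENNReal.ofReal ((∫ x in (0:ℝ)..1, ‖h (x + t) - h x‖ ^ 2) / Real.sin (Real.pi * t) ^ 2) := by
    rw [← intervalIntegral.integral_div, intervalIntegral.integral_of_le zero_le_one,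
      ofReal_integral_eq_lintegral_ofReal]
    · apply lintegral_congr
      intro x
      rw [hh, ← Complex.ofReal_sub, Complex.norm_real, Real.norm_eq_abs, sq_abs]
    · exact (by fun_prop : Continuous _).integrableOn_Ioc
    · exact Filter.Eventually.of_forall fun x => by positivity
  rw [hl, ← hP2.tsum_eq, ENNReal.ofReal_tsum_of_nonneg (fun n => by positivity) hP2.summable]
  apply tsum_congr
  intro n
  rw [show (4 : ENNReal) = ENNReal.ofReal 4 by simp, ← ENNReal.ofReal_mul (by norm_num),
    ← ENNReal.ofReal_mul (by positivity)]
  congr 1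
  ring

/-- Dirichlet kernel -/
noncomputable def Dk (k : ℕ) (t : ℝ) : ℝ :=
  1 + ∑ j ∈ Finset.range k, 2 * Real.cos (2 * Real.pi * (j + 1) * t)

lemma Dk_sin (k : ℕ) (t : ℝ) :
    Real.sin (Real.pi * t) * Dk k t = Real.sin ((2 * k + 1) * (Real.pi * t)) := by
  induction k with
  | zero => simp [Dk]
  | succ k ih =>
    have : Dk (k + 1) t = Dk k t + 2 * Real.cos (2 * Real.pi * (k + 1) * t) := by
      unfold Dk; rw [Finset.sum_range_succ]; ring
    rw [this, mul_add, ih]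
    have e1 : (2 * (k:ℝ) + 1) * (Real.pi * t) = 2 * Real.pi * (k + 1) * t - Real.pi * t := by ring
    have e2 : (2 * ((k + 1 : ℕ):ℝ) + 1) * (Real.pi * t) =
      2 * Real.pi * (k + 1) * t + Real.pi * t := by push_cast; ring
    rw [e1, e2, Real.sin_sub, Real.sin_add]
    ring

lemma Fe_sin (n : ℕ) (t : ℝ) :
    Real.sin (Real.pi * t) ^ 2 * ∑ k ∈ Finset.range n, Dk k t = Real.sin (n * (Real.pi * t)) ^ 2 := by
  induction n with
  | zero => simp
  | succ n ih =>
    rw [Finset.sum_range_succ, mul_add, ih, pow_two (Real.sin (Real.pi * t)), mul_assoc, Dk_sin]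
    have e1 : (2 * (n:ℝ) + 1) * (Real.pi * t) = n * (Real.pi * t) + (n * (Real.pi * t) + Real.pi * t) := by
      ring
    have e2 : ((n + 1 : ℕ):ℝ) * (Real.pi * t) = n * (Real.pi * t) + Real.pi * t := by push_cast; ring
    rw [e1, e2, Real.sin_add (n * (Real.pi * t)) (n * (Real.pi * t) + Real.pi * t),
      Real.sin_add, Real.cos_add]
    set a := n * (Real.pi * t)
    set b := Real.pi * t
    have h1 := Real.sin_sq_add_cos_sq a
    have h2 := Real.sin_sq_add_cos_sq b
    linear_combination (- Real.sin a ^ 2 ) * h2 + (Real.sin b ^ 2) * h1 - (Real.sin b ^ 2) * h1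

lemma Dk_integral (k : ℕ) : ∫ t in (0:ℝ)..1, Dk k t = 1 := by
  unfold Dk
  rw [intervalIntegral.integral_add, intervalIntegral.integral_finsetSum]
  · simp only [intervalIntegral.integral_const, sub_zero, smul_eq_mul, mul_one]
    rw [Finset.sum_eq_zero, add_zero]
    intro j _
    rw [intervalIntegral.integral_const_mul,
      intervalIntegral.integral_comp_mul_left (fun x => Real.cos x) (by positivity), integral_cos]
    have : Real.sin (2 * Real.pi * (j + 1) * 1) = 0 := by
      have := Real.sin_nat_mul_pi (2 * (j + 1))
      rw [← this]; congr 1; push_cast; ring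
    rw [this]; simp
  · intro j _
    exact (by fun_prop : Continuous _).intervalIntegrable _ _
  · exact (by fun_prop : Continuous _).intervalIntegrable _ _
  · exact (by fun_prop : Continuous _).intervalIntegrable _ _

lemma Dk_cont (k : ℕ) : Continuous (Dk k) := by unfold Dk; fun_prop

lemma fejer_nat (n : ℕ) :
    ∫⁻ t in Ioc (0:ℝ) 1,
      ENNReal.ofReal (Real.sin (n * (Real.pi * t)) ^ 2 / Real.sin (Real.pi * t) ^ 2) = n := by
  have hF : Continuous fun t => ∑ k ∈ Finset.range n, Dk k t :=
    continuous_finsetSum _ fun k _ => Dk_cont k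
  have key : ∀ t ∈ Ioo (0:ℝ) 1, Real.sin (n * (Real.pi * t)) ^ 2 / Real.sin (Real.pi * t) ^ 2 =
      ∑ k ∈ Finset.range n, Dk k t := by
    intro t ht
    have hs : 0 < Real.sin (Real.pi * t) := by
      apply Real.sin_pos_of_pos_of_lt_pi
      · exact mul_pos Real.pi_pos ht.1
      · nlinarith [Real.pi_pos, ht.2]
    rw [← Fe_sin]
    field_simp
  rw [← restrict_Ioo_eq_restrict_Ioc,
    setLIntegral_congr_fun (g := fun t => ENNReal.ofReal (∑ k ∈ Finset.range n, Dk k t))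
      measurableSet_Ioo (fun t ht => by simp only [key t ht]),
    ← ofReal_integral_eq_lintegral_ofReal]
  · rw [restrict_Ioo_eq_restrict_Ioc, ← intervalIntegral.integral_of_le zero_le_one,
      intervalIntegral.integral_finsetSum]
    · simp [Dk_integral]
    · intro k _
      exact (Dk_cont k).intervalIntegrable _ _
  · exact hF.integrableOn_Ioc.mono_set Ioo_subset_Ioc_self
  · refine (ae_restrict_iff' measurableSet_Ioo).2 (Filter.Eventually.of_forall fun t ht => ?_)
    simp only [Pi.zero_apply]
    rw [← key t ht]
    positivity

lemma fejer_int (n : ℤ) :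
    ∫⁻ t in Ioc (0:ℝ) 1,
      ENNReal.ofReal (Real.sin (Real.pi * n * t) ^ 2 / Real.sin (Real.pi * t) ^ 2) = n.natAbs := by
  rw [← fejer_nat]
  apply lintegral_congr
  intro t
  congr 2
  have h : ((n.natAbs : ℕ) : ℝ) = |(n:ℝ)| := by
    rw [Nat.cast_natAbs, Int.cast_abs]
  rw [h]
  rcases abs_choice (n:ℝ) with h | h <;> rw [h]
  · congr 2; ring
  · rw [neg_mul, Real.sin_neg, neg_sq]; congr 2; ring

lemma douglas (g : ℝ → ℝ) (hc : Continuous g) (hp : Function.Periodic g 1) :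
    De g = 4 * H12seminormSq g := by
  unfold De H12seminormSq
  simp_rw [inner_eq g hc hp]
  rw [lintegral_tsum, ← ENNReal.tsum_mul_left]
  · apply tsum_congr
    intro n
    rw [lintegral_mul_const, fejer_int, ENNReal.ofReal_pow (norm_nonneg _), ofReal_norm,
      enorm_eq_nnnorm]
    · ring
    · fun_prop
  · intro n
    fun_prop


/-! ### Part 2: lifts and test functions -/

lemma lift_cont {φ : ℝ → ℝ} (h : IsCircleLift φ) : Continuous φ :=
  h.1.monotone.continuous_of_surjective h.2.1

lemma per_lint (h : ℝ → ENNReal) (hp : Function.Periodic h 1) (a : ℝ) :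
    ∫⁻ x in Ioc a (a + 1), h x = ∫⁻ x in Ioc (0:ℝ) 1, h x := by
  have h1 := UnitAddCircle.lintegral_preimage a hp.lift
  have h2 := UnitAddCircle.lintegral_preimage 0 hp.lift
  simp only [Function.Periodic.lift_coe, zero_add] at h1 h2
  rw [h1, h2]

lemma min_gap {φ : ℝ → ℝ} (h : IsCircleLift φ) {s : ℝ} (hs : 0 < s) :
    ∃ m : ℝ, 0 < m ∧ ∀ x, m ≤ φ (x + s) - φ x := by
  have hc := lift_cont h
  obtain ⟨x0, hx0, hmin⟩ := isCompact_Icc.exists_isMinOn (s := Icc (0:ℝ) 1) ⟨0, by simp⟩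
    ((by fun_prop : Continuous fun x => φ (x + s) - φ x).continuousOn)
  refine ⟨φ (x0 + s) - φ x0, sub_pos.2 (h.1 (by linarith)), fun x => ?_⟩
  have hp : Function.Periodic (fun x => φ (x + s) - φ x) 1 := by
    intro x
    simp only
    rw [add_right_comm, h.2.2, h.2.2]; ring
  obtain ⟨y, hy, hxy⟩ := hp.exists_mem_Ico₀ zero_lt_one x
  rw [hxy]
  exact hmin (Ico_subset_Icc_self hy)

lemma small_gap {φ : ℝ → ℝ} (h : IsCircleLift φ) :
    ∃ s : ℝ, 0 < s ∧ ∀ x t, t ≤ s → φ (x + t) ≤ φ x + 1 / 2 := by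
  obtain ⟨ψ, hψ⟩ := h.2.1.hasRightInverse
  have hl : IsCircleLift ψ := by
    refine ⟨fun a b hab => h.1.lt_iff_lt.1 (by rwa [hψ, hψ]), fun x => ⟨φ x, h.1.injective (hψ _)⟩,
      fun x => h.1.injective ?_⟩
    rw [hψ, h.2.2, hψ]
  obtain ⟨m, hm, hmin⟩ := min_gap hl (s := 1 / 2) (by norm_num)
  refine ⟨m, hm, fun x t ht => ?_⟩
  have h1 := hmin (φ x)
  have h2 : ψ (φ x) = x := h.1.injective (hψ _)
  rw [h2] at h1
  calc φ (x + t) ≤ φ (ψ (φ x + 1 / 2)) := h.1.monotone (by linarith)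
    _ = _ := hψ _

lemma sum_Icc_symm {A : Type*} [AddCommMonoid A] (F : ℤ → A) (N : ℕ) :
    ∑ k ∈ Finset.Icc (-(N:ℤ)) N, F k =
      F 0 + ∑ n ∈ Finset.range N, (F ((n + 1 : ℕ) : ℤ) + F (-((n + 1 : ℕ) : ℤ))) := by
  induction N with
  | zero => simp
  | succ N ih =>
    have : Finset.Icc (-((N + 1 : ℕ):ℤ)) ((N + 1 : ℕ):ℤ) =
        insert (((N + 1 : ℕ):ℤ)) (insert (-((N + 1 : ℕ):ℤ)) (Finset.Icc (-(N:ℤ)) N)) := by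
      ext k
      simp only [Finset.mem_insert, Finset.mem_Icc]
      omega
    rw [this, Finset.sum_insert, Finset.sum_insert, ih, Finset.sum_range_succ]
    · abel
    · simp
    · simp only [Finset.mem_insert, Finset.mem_Icc]
      omega

lemma exp_int_integral (m : ℤ) :
    ∫ x in (0:ℝ)..1, Complex.exp (2 * Real.pi * Complex.I * m * x) = if m = 0 then 1 else 0 := by
  split_ifs with h
  · simp [h]
  · have hc : (2 * Real.pi * Complex.I * m : ℂ) ≠ 0 := by
      simp [Real.pi_ne_zero, h]
    rw [integral_exp_mul_complex hc]
    have : (2 * Real.pi * Complex.I * m : ℂ) * ((1:ℝ):ℂ) = m * (2 * Real.pi * Complex.I) := by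
      push_cast; ring
    rw [this, Complex.exp_int_mul_two_pi_mul_I]
    simp

lemma coeff_trig (f : ℝ → ℂ) (s : Finset ℤ) (c : ℤ → ℂ) (hs : ∀ n, n ∉ s → c n = 0)
    (hf : ∀ x : ℝ, f x = ∑ n ∈ s, c n * Complex.exp (2 * Real.pi * Complex.I * n * x)) (n : ℤ) :
    fourierCoeff1 f n = c n := by
  unfold fourierCoeff1
  have : ∀ x : ℝ, f x * Complex.exp (-(2 * Real.pi * Complex.I * n * x)) =
      ∑ k ∈ s, c k * Complex.exp (2 * Real.pi * Complex.I * (k - n : ℤ) * x) := by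
    intro x
    rw [hf, Finset.sum_mul]
    refine Finset.sum_congr rfl fun k _ => ?_
    rw [mul_assoc, ← Complex.exp_add]
    congr 2
    push_cast; ring
  simp_rw [this]
  rw [intervalIntegral.integral_finsetSum]
  · simp_rw [intervalIntegral.integral_const_mul, exp_int_integral]
    simp only [mul_ite, mul_one, mul_zero, sub_eq_zero]
    rw [Finset.sum_ite_eq' s n c]
    split_ifs with h
    · rfl
    · exact (hs n h).symm
  · intro k _
    exact (by fun_prop : Continuous _).intervalIntegrable _ _

/-- trigonometric polynomials with real cosine coefficients about a centre -/
lemma cos_poly (b : ℕ → ℝ) (hb0 : b 0 = 0) (N : ℕ) (β : ℝ) :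
    IsRealTrigPoly (fun s => ∑ n ∈ Finset.range (N + 1), b n * Real.cos (2 * Real.pi * n * (s - β))) ∧
    H12seminormSq (fun s => ∑ n ∈ Finset.range (N + 1), b n * Real.cos (2 * Real.pi * n * (s - β))) =
      ENNReal.ofReal (1 / 2 * ∑ n ∈ Finset.range N, ((n:ℝ) + 1) * b (n + 1) ^ 2) := by
  set f : ℝ → ℝ :=
    fun s => ∑ n ∈ Finset.range (N + 1), b n * Real.cos (2 * Real.pi * n * (s - β)) with hf
  set c : ℤ → ℂ := fun k => if |k| ≤ N then
    (b k.natAbs / 2 : ℂ) * Complex.exp (-(2 * Real.pi * Complex.I * k * β)) else 0 with hc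
  have hfc : ∀ x : ℝ, (f x : ℂ) = ∑ n ∈ Finset.Icc (-(N:ℤ)) N,
      c n * Complex.exp (2 * Real.pi * Complex.I * n * x) := by
    intro x
    rw [sum_Icc_symm]
    simp only [hf]
    rw [Finset.sum_range_succ']
    have h0 : c 0 = 0 := by simp [hc, hb0]
    rw [h0, hb0]
    push_cast
    rw [zero_mul, zero_mul, add_zero, zero_add]
    refine Finset.sum_congr rfl fun n hn => ?_
    have hn' : n < N := Finset.mem_range.1 hn
    have a1 : |(n:ℤ) + 1| ≤ N := by rw [abs_le]; omega
    have a2 : |-1 + -(n:ℤ)| ≤ N := by rw [abs_le]; omega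
    have n1 : ((n:ℤ) + 1).natAbs = n + 1 := by omega
    have n2 : (-1 + -(n:ℤ)).natAbs = n + 1 := by omega
    simp only [hc, neg_add_rev, if_pos a1, if_pos a2, n1, n2]
    rw [mul_assoc (_ / _), mul_assoc (_ / _), ← Complex.exp_add, ← Complex.exp_add, Complex.cos]
    rw [show (2 * Real.pi * ((n:ℂ) + 1) * (x - β)) * Complex.I =
        -(2 * Real.pi * Complex.I * (((n:ℤ) + 1 : ℤ):ℂ) * β) + 2 * Real.pi * Complex.I * ((n:ℂ) + 1) * x by
        push_cast; ring]
    rw [show -(2 * Real.pi * ((n:ℂ) + 1) * (x - β)) * Complex.I =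
        -(2 * Real.pi * Complex.I * ((-1 + -(n:ℤ) : ℤ):ℂ) * β) +
          2 * Real.pi * Complex.I * (-1 + -(n:ℂ)) * x by
        push_cast; ring]
    push_cast
    ring
  have hcs : ∀ n : ℤ, n ∉ Finset.Icc (-(N:ℤ)) N → c n = 0 := by
    intro n hn
    rw [Finset.mem_Icc, ← abs_le] at hn
    simp [hc, hn]
  refine ⟨⟨N, c, ?_, ?_, hfc⟩, ?_⟩
  · intro n hn
    simp only [hc, if_neg (not_le.2 hn)]
  · intro n
    simp only [hc, abs_neg, Int.natAbs_neg]
    split_ifs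
    · rw [map_mul, ← Complex.exp_conj]
      congr 1
      · simp [Complex.conj_ofNat]
      · congr 1
        simp [Complex.conj_ofNat]
    · simp
  · unfold H12seminormSq
    simp_rw [coeff_trig (fun x => (f x : ℂ)) _ c hcs hfc]
    rw [tsum_eq_sum (s := Finset.Icc (-(N:ℤ)) N), sum_Icc_symm]
    · simp only [Int.natAbs_zero, Nat.cast_zero, zero_mul, zero_add]
      rw [Finset.mul_sum, ENNReal.ofReal_sum_of_nonneg (fun n _ => by positivity)]
      refine Finset.sum_congr rfl fun n hn => ?_
      have hn' : n < N := Finset.mem_range.1 hn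
      have key : ∀ k : ℤ, k.natAbs = n + 1 →
          (k.natAbs : ENNReal) * (‖c k‖₊ : ENNReal) ^ 2 =
            ENNReal.ofReal (((n:ℝ) + 1) * (b (n + 1) / 2) ^ 2) := by
        intro k hk
        have hk' : |k| ≤ N := by rw [abs_le]; omega
        have : ‖c k‖ = |b (n + 1) / 2| := by
          simp only [hc, if_pos hk', hk]
          rw [norm_mul]
          have : -(2 * Real.pi * Complex.I * k * β) = ((-(2 * Real.pi * k * β) : ℝ) : ℂ) * Complex.I := by
            push_cast; ring
          rw [this, Complex.norm_exp_ofReal_mul_I, mul_one]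
          rw [show (b (n + 1) / 2 : ℂ) = ((b (n + 1) / 2 : ℝ) : ℂ) by push_cast; rfl,
            Complex.norm_real, Real.norm_eq_abs]
        rw [← enorm_eq_nnnorm, ← ofReal_norm, this, hk, ← ENNReal.ofReal_pow (abs_nonneg _), sq_abs,
          ENNReal.ofReal_mul (by positivity)]
        congr 1
        rw [← ENNReal.ofReal_natCast]; push_cast; rfl
      rw [key _ (by omega), key _ (by omega), ← ENNReal.ofReal_add (by positivity) (by positivity)]
      congr 1
      ring
    · intro k hk
      simp [hcs k hk]


/-- squared modulus of `1 - ρ e^{2πis}` -/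
noncomputable def PP (ρ s : ℝ) : ℝ := (1 - ρ) ^ 2 + 4 * ρ * Real.sin (Real.pi * s) ^ 2

lemma hasSum_PP {ρ : ℝ} (h0 : 0 ≤ ρ) (h1 : ρ < 1) (s : ℝ) :
    HasSum (fun n : ℕ => ρ ^ n / n * Real.cos (2 * Real.pi * n * s)) (-(1 / 2 * Real.log (PP ρ s))) := by
  set z : ℂ := ρ * Complex.exp ((2 * Real.pi * s : ℝ) * Complex.I) with hz
  have hzn : ‖z‖ < 1 := by
    rw [hz, norm_mul, Complex.norm_exp_ofReal_mul_I, mul_one, Complex.norm_real, Real.norm_eq_abs,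
      abs_of_nonneg h0]
    exact h1
  have h := Complex.hasSum_re (Complex.hasSum_taylorSeries_neg_log hzn)
  convert h using 1
  · ext n
    rw [hz, mul_pow, ← Complex.exp_nat_mul]
    rw [show (n:ℂ) * (((2 * Real.pi * s : ℝ) : ℂ) * Complex.I) =
      ((2 * Real.pi * n * s : ℝ) : ℂ) * Complex.I by push_cast; ring]
    rw [show (ρ:ℂ) ^ n * Complex.exp (((2 * Real.pi * n * s : ℝ) : ℂ) * Complex.I) / n =
      ((ρ ^ n / n : ℝ) : ℂ) * Complex.exp (((2 * Real.pi * n * s : ℝ) : ℂ) * Complex.I) by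
        push_cast; ring]
    rw [Complex.re_ofReal_mul, Complex.exp_ofReal_mul_I_re]
  · rw [Complex.neg_re, Complex.log_re]
    congr 1
    have : PP ρ s = ‖1 - z‖ ^ 2 := by
      rw [← Complex.normSq_eq_norm_sq, Complex.normSq_apply]
      simp only [hz, Complex.sub_re, Complex.sub_im, Complex.one_re, Complex.one_im,
        Complex.re_ofReal_mul, Complex.im_ofReal_mul, Complex.exp_ofReal_mul_I_re,
        Complex.exp_ofReal_mul_I_im]
      have e1 : 2 * Real.pi * s = 2 * (Real.pi * s) := by ring
      rw [e1, Real.cos_two_mul, Real.sin_two_mul, PP]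
      have := Real.sin_sq_add_cos_sq (Real.pi * s)
      have e2 : Real.sin (Real.pi * s) ^ 2 = 1 - Real.cos (Real.pi * s) ^ 2 := by linarith
      linear_combination (4 * ρ - 4 * ρ ^ 2 * Real.cos (Real.pi * s) ^ 2) * e2
    rw [this, Real.log_pow]
    push_cast; ring

lemma energy_bound {r R : ℝ} (hr : 0 < r) (hR : 1 ≤ R) (hRr : R * r ≤ 1 / 2) (N : ℕ) :
    ∑ n ∈ Finset.range N, ((n:ℝ) + 1) *
      (((1 - r) ^ (n + 1) - (1 - R * r) ^ (n + 1)) / ((n + 1 : ℕ) : ℝ)) ^ 2 ≤ Real.log (4 * R) := by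
  have hrR : r ≤ R * r := by nlinarith
  set ρ := 1 - r with hρ
  set σ := 1 - R * r with hσ
  have h1 := Real.hasSum_pow_div_log_of_abs_lt_one (x := ρ ^ 2) (by
    rw [abs_of_nonneg (by positivity)]; nlinarith)
  have h2 := Real.hasSum_pow_div_log_of_abs_lt_one (x := σ ^ 2) (by
    rw [abs_of_nonneg (by positivity)]; nlinarith)
  have h3 := Real.hasSum_pow_div_log_of_abs_lt_one (x := ρ * σ) (by
    rw [abs_of_nonneg (by nlinarith)]; nlinarith)
  have h := (h1.add h2).sub (h3.mul_left 2)
  have hle := sum_le_hasSum (Finset.range N) (fun n _ => by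
    rw [show (ρ ^ 2) ^ (n + 1) / ((n:ℝ) + 1) + (σ ^ 2) ^ (n + 1) / ((n:ℝ) + 1) -
      2 * ((ρ * σ) ^ (n + 1) / ((n:ℝ) + 1)) = (ρ ^ (n + 1) - σ ^ (n + 1)) ^ 2 / ((n:ℝ) + 1) by
        rw [mul_pow ρ σ, ← pow_mul, ← pow_mul]; ring]
    positivity) h
  have e : ∀ n : ℕ, ((n:ℝ) + 1) * ((ρ ^ (n + 1) - σ ^ (n + 1)) / ((n + 1 : ℕ) : ℝ)) ^ 2 =
      (ρ ^ 2) ^ (n + 1) / ((n:ℝ) + 1) + (σ ^ 2) ^ (n + 1) / ((n:ℝ) + 1) -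
      2 * ((ρ * σ) ^ (n + 1) / ((n:ℝ) + 1)) := by
    intro n
    have hn : (n:ℝ) + 1 ≠ 0 := by positivity
    push_cast
    rw [mul_pow ρ σ, ← pow_mul, ← pow_mul]
    field_simp
    ring
  simp_rw [e]
  refine hle.trans ?_
  have p1 : 0 < 1 - ρ ^ 2 := by nlinarith
  have p2 : 0 < 1 - σ ^ 2 := by nlinarith
  have p3 : 0 < 1 - ρ * σ := by nlinarith
  have hA : Real.log (1 - ρ * σ) ≤ Real.log (2 * (R * r)) := Real.log_le_log p3 (by nlinarith)
  have hB : Real.log r ≤ Real.log (1 - ρ ^ 2) := Real.log_le_log hr (by nlinarith)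
  have hC : Real.log (R * r) ≤ Real.log (1 - σ ^ 2) := Real.log_le_log (by positivity) (by nlinarith)
  have hR0 : 0 < R := by linarith
  rw [Real.log_mul (by norm_num) (by positivity), Real.log_mul (by positivity) (by positivity)] at hA
  rw [Real.log_mul (by positivity) (by positivity)] at hC
  rw [Real.log_mul (by norm_num) (by positivity), show (4:ℝ) = 2 ^ 2 by norm_num, Real.log_pow]
  push_cast
  linarith

lemma PP_near {r R s : ℝ} (hr : 0 < r) (hR : 1 ≤ R) (hRr : R * r ≤ 1 / 2) (hs : |s| ≤ r) :
    Real.log (R / 8) ≤ 1 / 2 * Real.log (PP (1 - R * r) s) - 1 / 2 * Real.log (PP (1 - r) s) := by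
  have hrR : r ≤ R * r := by nlinarith
  have hpi := Real.pi_lt_d2
  have hpi0 := Real.pi_pos
  have h1 : Real.sin (Real.pi * s) ^ 2 ≤ 10 * r ^ 2 := by
    have : |Real.sin (Real.pi * s)| ≤ |Real.pi * s| := Real.abs_sin_le_abs
    rw [← sq_abs]
    calc |Real.sin (Real.pi * s)| ^ 2 ≤ |Real.pi * s| ^ 2 := by gcongr
      _ = Real.pi ^ 2 * |s| ^ 2 := by rw [abs_mul, mul_pow, abs_of_pos hpi0]
      _ ≤ 10 * r ^ 2 := by gcongr; nlinarith
  have h2 : PP (1 - r) s ≤ (8 * r) ^ 2 := by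
    unfold PP
    nlinarith [sq_nonneg (Real.sin (Real.pi * s))]
  have h3 : 0 < PP (1 - r) s := by
    unfold PP
    nlinarith [sq_nonneg (Real.sin (Real.pi * s))]
  have h4 : (R * r) ^ 2 ≤ PP (1 - R * r) s := by
    unfold PP
    nlinarith [sq_nonneg (Real.sin (Real.pi * s))]
  have hR0 : 0 < R := by linarith
  have a := Real.log_le_log h3 h2
  have b := Real.log_le_log (by positivity) h4
  rw [Real.log_pow, Real.log_mul (by norm_num) hr.ne'] at a
  rw [Real.log_pow, Real.log_mul (by positivity) hr.ne'] at b
  rw [Real.log_div hR0.ne' (by norm_num)]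
  push_cast at a b
  linarith

lemma PP_far {r R s : ℝ} (hr : 0 < r) (hR : 1 ≤ R) (hs : R * r ≤ |s|) (hs2 : |s| ≤ 1 / 2) :
    1 / 2 * Real.log (PP (1 - R * r) s) - 1 / 2 * Real.log (PP (1 - r) s) ≤ Real.log 2 := by
  have hrR : r ≤ R * r := by nlinarith
  have h1 : 4 * (R * r) ^ 2 ≤ Real.sin (Real.pi * s) ^ 2 := by
    have h := Real.mul_le_sin (x := Real.pi * |s|) (by positivity) (by nlinarith [Real.pi_pos])
    have e : 2 / Real.pi * (Real.pi * |s|) = 2 * |s| := by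
      have := Real.pi_ne_zero
      field_simp
    rw [e] at h
    have e2 : Real.sin (Real.pi * s) ^ 2 = Real.sin (Real.pi * |s|) ^ 2 := by
      rcases abs_choice s with h | h <;> rw [h]
      rw [mul_neg, Real.sin_neg, neg_sq]
    rw [e2]
    have : 0 < R * r := by linarith
    nlinarith
  have hq : 0 < (R * r) ^ 2 := by have : 0 < R * r := by linarith
                                  positivity
  have h2 : PP (1 - R * r) s ≤ 4 * PP (1 - r) s := by
    unfold PP
    nlinarith [sq_nonneg r]
  have h3 : 0 < PP (1 - R * r) s := by
    unfold PP
    nlinarith [sq_nonneg (Real.sin (Real.pi * s))]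
  have h4 : 0 < PP (1 - r) s := by linarith
  have a := Real.log_le_log h3 h2
  rw [Real.log_mul (by norm_num) h4.ne', show (4:ℝ) = 2 ^ 2 by norm_num, Real.log_pow] at a
  push_cast at a
  linarith

lemma test_fn {r R : ℝ} (β : ℝ) (hr : 0 < r) (hR : 1 ≤ R) (hRr : R * r ≤ 1 / 2) :
    ∃ f : ℝ → ℝ, IsRealTrigPoly f ∧ H12seminormSq f ≤ ENNReal.ofReal (1 / 2 * Real.log (4 * R)) ∧
      ∀ s s', |s - β| ≤ r → R * r ≤ |s' - β| → |s' - β| ≤ 1 / 2 →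
        Real.log (R / 16) - 2 ≤ f s - f s' := by
  have hrR : r ≤ R * r := by nlinarith
  set b : ℕ → ℝ := fun n => ((1 - r) ^ n - (1 - R * r) ^ n) / n with hb
  set H : ℝ → ℝ := fun s => 1 / 2 * Real.log (PP (1 - R * r) s) - 1 / 2 * Real.log (PP (1 - r) s)
    with hH
  have hsum : ∀ s, HasSum (fun n : ℕ => b n * Real.cos (2 * Real.pi * n * s)) (H s) := by
    intro s
    have := (hasSum_PP (ρ := 1 - r) (by linarith) (by linarith) s).sub
      (hasSum_PP (ρ := 1 - R * r) (by linarith) (by linarith) s)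
    have e1 : H s = -(1 / 2 * Real.log (PP (1 - r) s)) - -(1 / 2 * Real.log (PP (1 - R * r) s)) := by
      simp only [hH]; ring
    rw [e1]
    have e2 : (fun n : ℕ => b n * Real.cos (2 * Real.pi * n * s)) = fun n : ℕ =>
        (1 - r) ^ n / n * Real.cos (2 * Real.pi * n * s) -
          (1 - R * r) ^ n / n * Real.cos (2 * Real.pi * n * s) := by
      funext n; simp only [hb]; ring
    rw [e2]
    exact this
  have hsb : Summable fun n => |b n| := by
    refine Summable.of_nonneg_of_le (fun n => abs_nonneg _) (fun n => ?_)
      ((summable_geometric_of_lt_one (r := 1 - r) (by linarith) (by linarith)).add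
        (summable_geometric_of_lt_one (r := 1 - R * r) (by linarith) (by linarith)))
    have q1 : 0 ≤ (1 - r) ^ n := pow_nonneg (by linarith) _
    have q2 : 0 ≤ (1 - R * r) ^ n := pow_nonneg (by linarith) _
    simp only [hb]
    rw [abs_div, Nat.abs_cast]
    rcases Nat.eq_zero_or_pos n with h | h
    · subst h; simp
    · refine (div_le_self (abs_nonneg _) (by exact_mod_cast h)).trans ?_
      rw [abs_le]; constructor <;> linarith
  have hu := tendstoUniformly_tsum_nat (f := fun (n : ℕ) (s : ℝ) => b n * Real.cos (2 * Real.pi * n * s))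
    hsb (fun n s => by
      rw [Real.norm_eq_abs, abs_mul]
      exact mul_le_of_le_one_right (abs_nonneg _) (Real.abs_cos_le_one _))
  rw [Metric.tendstoUniformly_iff] at hu
  obtain ⟨N, hN⟩ := (Filter.eventually_atTop.1 (hu 1 one_pos))
  have hN' : ∀ s, |H s - ∑ n ∈ Finset.range (N + 1), b n * Real.cos (2 * Real.pi * n * s)| < 1 := by
    intro s
    have := hN (N + 1) (by omega) s
    rwa [(hsum s).tsum_eq, Real.dist_eq] at this
  obtain ⟨ht, he⟩ := cos_poly b (by simp [hb]) N β
  refine ⟨_, ht, ?_, ?_⟩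
  · rw [he]
    apply ENNReal.ofReal_le_ofReal
    have := energy_bound hr hR hRr N
    simp only [hb]
    linarith
  · intro s s' h1 h2 h3
    have a1 := abs_lt.1 (hN' (s - β))
    have a2 := abs_lt.1 (hN' (s' - β))
    have b1 := PP_near hr hR hRr h1
    have b2 := PP_far hr hR h2 h3
    have hR0 : 0 < R := by linarith
    rw [Real.log_div hR0.ne' (by norm_num)] at b1 ⊢
    have l8 : Real.log 8 = 3 * Real.log 2 := by
      rw [show (8:ℝ) = 2 ^ 3 by norm_num, Real.log_pow]; norm_num
    have l16 : Real.log 16 = 4 * Real.log 2 := by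
      rw [show (16:ℝ) = 2 ^ 4 by norm_num, Real.log_pow]; norm_num
    simp only [hH] at a1 a2
    linarith [a1.1, a1.2, a2.1, a2.2]

lemma De_lower (g : ℝ → ℝ) (hp : Function.Periodic g 1) {t δ : ℝ} (ht : 0 < t) (ht2 : 3 * t < 1)
    (hδ : ∀ τ ∈ Ioc (2 * t) (3 * t), ∃ a, ∀ y ∈ Ioc a (a + t), δ ^ 2 ≤ (g (y + τ) - g y) ^ 2) :
    ENNReal.ofReal (δ ^ 2 / (9 * Real.pi ^ 2)) ≤ De g := by
  have hpi := Real.pi_pos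
  have h1 : ∀ τ ∈ Ioc (2 * t) (3 * t), ENNReal.ofReal (δ ^ 2 / (9 * Real.pi ^ 2 * t ^ 2) * t) ≤
      ∫⁻ x in Ioc (0:ℝ) 1, ENNReal.ofReal ((g (x + τ) - g x) ^ 2 / Real.sin (Real.pi * τ) ^ 2) := by
    intro τ hτ
    obtain ⟨a, ha⟩ := hδ τ hτ
    have hs : 0 < Real.sin (Real.pi * τ) := by
      apply Real.sin_pos_of_pos_of_lt_pi
      · exact mul_pos hpi (by linarith [hτ.1])
      · nlinarith [hτ.2]
    have hs2 : Real.sin (Real.pi * τ) ≤ Real.pi * τ :=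
      Real.sin_le (mul_nonneg hpi.le (by linarith [hτ.1]))
    have hs3 : Real.sin (Real.pi * τ) ≤ Real.pi * (3 * t) :=
      hs2.trans (by gcongr; exact hτ.2)
    rw [← per_lint _ _ a]
    · calc ENNReal.ofReal (δ ^ 2 / (9 * Real.pi ^ 2 * t ^ 2) * t)
          = ∫⁻ x in Ioc a (a + t), ENNReal.ofReal (δ ^ 2 / (9 * Real.pi ^ 2 * t ^ 2)) := by
            rw [setLIntegral_const, Real.volume_Ioc, ENNReal.ofReal_mul (by positivity)]
            simp
        _ ≤ ∫⁻ x in Ioc a (a + t),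
            ENNReal.ofReal ((g (x + τ) - g x) ^ 2 / Real.sin (Real.pi * τ) ^ 2) := by
            apply setLIntegral_mono' measurableSet_Ioc
            intro y hy
            apply ENNReal.ofReal_le_ofReal
            apply div_le_div₀ (by positivity) (ha y hy) (by positivity)
            calc Real.sin (Real.pi * τ) ^ 2 ≤ (Real.pi * (3 * t)) ^ 2 := by gcongr
              _ = _ := by ring
        _ ≤ _ := lintegral_mono_set (Ioc_subset_Ioc_right (by linarith))
    · intro x
      simp only
      rw [add_right_comm, hp, hp]
  calc ENNReal.ofReal (δ ^ 2 / (9 * Real.pi ^ 2))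
      = ∫⁻ τ in Ioc (2 * t) (3 * t), ENNReal.ofReal (δ ^ 2 / (9 * Real.pi ^ 2 * t ^ 2) * t) := by
        rw [setLIntegral_const, Real.volume_Ioc, ← ENNReal.ofReal_mul (by positivity)]
        congr 1
        field_simp
        ring
    _ ≤ ∫⁻ τ in Ioc (2 * t) (3 * t), ∫⁻ x in Ioc (0:ℝ) 1,
          ENNReal.ofReal ((g (x + τ) - g x) ^ 2 / Real.sin (Real.pi * τ) ^ 2) :=
        setLIntegral_mono' measurableSet_Ioc h1
    _ ≤ De g := lintegral_mono_set (Ioc_subset_Ioc (by linarith) (by linarith))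

lemma eventually_growth (K : ℝ) :
    ∃ R0 : ℝ, 1 ≤ R0 ∧ ∀ R, R0 ≤ R →
      0 ≤ Real.log (R / 16) - 2 ∧ K * Real.log (4 * R) < (Real.log (R / 16) - 2) ^ 2 := by
  -- with y = log (R/16) - 2, log (4R) = y + 2 + log 64
  set A := 2 + Real.log 64 with hA
  have hA0 : 0 < A := by have := Real.log_pos (show (1:ℝ) < 64 by norm_num); linarith
  set y0 := |K| * (1 + A) + 1 with hy0
  have hK := abs_nonneg K
  have hy1 : 1 ≤ y0 := by nlinarith
  refine ⟨16 * Real.exp (y0 + 2), ?_, fun R hR => ?_⟩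
  · have := Real.add_one_le_exp (y0 + 2); linarith
  have hRpos : 0 < R := lt_of_lt_of_le (by positivity) hR
  have h1 : y0 + 2 ≤ Real.log (R / 16) := by
    rw [Real.le_log_iff_exp_le (by positivity)]
    linarith
  have h2 : Real.log (4 * R) = Real.log (R / 16) + Real.log 64 := by
    rw [← Real.log_mul (by positivity) (by norm_num)]; congr 1; ring
  set y := Real.log (R / 16) - 2 with hy
  have h3 : Real.log (4 * R) = y + A := by rw [h2, hy, hA]; ring
  rw [h3]
  have hyy : y0 ≤ y := by linarith
  refine ⟨by linarith, ?_⟩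
  have h4 : K * (y + A) ≤ |K| * (y + A) := by
    apply mul_le_mul_of_nonneg_right (le_abs_self K); linarith
  have h5 : |K| * (y + A) ≤ |K| * ((1 + A) * y) := by
    apply mul_le_mul_of_nonneg_left _ hK; nlinarith
  nlinarith

lemma trig_cont_per {f : ℝ → ℝ} (h : IsRealTrigPoly f) :
    Continuous f ∧ Function.Periodic f 1 := by
  obtain ⟨N, c, -, -, hf⟩ := h
  have hc : Continuous fun x => (f x : ℂ) := by
    simp_rw [hf]
    fun_prop
  constructor
  · have := Complex.continuous_re.comp hc
    simpa [Function.comp_def] using this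
  · intro x
    have : (f (x + 1) : ℂ) = f x := by
      rw [hf, hf]
      refine Finset.sum_congr rfl fun n _ => ?_
      congr 1
      rw [show (2 * Real.pi * Complex.I * n * ((x + 1 : ℝ) : ℂ)) =
        2 * Real.pi * Complex.I * n * x + (n : ℂ) * (2 * Real.pi * Complex.I) by push_cast; ring,
        Complex.exp_add, Complex.exp_int_mul_two_pi_mul_I, mul_one]
    exact_mod_cast this

lemma comp_per {f φ : ℝ → ℝ} (hf : Function.Periodic f 1) (h : IsCircleLift φ) :
    Function.Periodic (f ∘ φ) 1 := by
  intro x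
  simp [h.2.2, hf (φ x)]

theorem bounded_imp_qs {φ : ℝ → ℝ} (h : IsCircleLift φ) {C : ℝ}
    (hC : ∀ f : ℝ → ℝ, IsRealTrigPoly f →
      H12seminormSq (f ∘ φ) ≤ ENNReal.ofReal (C ^ 2) * H12seminormSq f) :
    ∃ M : ℝ, QSConst φ M := by
  have hc := lift_cont h
  have hmono := h.1
  obtain ⟨R0, hR01, hR0⟩ := eventually_growth (18 * Real.pi ^ 2 * C ^ 2)
  obtain ⟨s, hs, hgap⟩ := small_gap h
  set t0 := min (s / 3) (1 / 4) with ht0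
  have ht0p : 0 < t0 := lt_min (by linarith) (by norm_num)
  have ht0a : t0 ≤ s / 3 := min_le_left _ _
  have ht0b : t0 ≤ 1 / 4 := min_le_right _ _
  obtain ⟨m, hm, hmin⟩ := min_gap h ht0p
  -- the core estimate
  have core : ∀ β r R : ℝ, 0 < r → R0 ≤ R → R * r ≤ 1 / 2 → ∀ t, 0 < t → t < t0 →
      (∀ τ ∈ Ioc (2 * t) (3 * t), ∃ a, ∀ y ∈ Ioc a (a + t),
        (|φ y - β| ≤ r ∧ R * r ≤ |φ (y + τ) - β| ∧ |φ (y + τ) - β| ≤ 1 / 2) ∨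
        (|φ (y + τ) - β| ≤ r ∧ R * r ≤ |φ y - β| ∧ |φ y - β| ≤ 1 / 2)) → False := by
    intro β r R hr hR hRr t ht htt hbox
    obtain ⟨f, hf, hfe, hfd⟩ := test_fn β hr (hR01.trans hR) hRr
    obtain ⟨g1, g2⟩ := hR0 R hR
    obtain ⟨fc, fp⟩ := trig_cont_per hf
    have hl := De_lower (f ∘ φ) (comp_per fp h) (t := t) (δ := Real.log (R / 16) - 2) ht (by linarith)
      (by
        intro τ hτ
        obtain ⟨a, ha⟩ := hbox τ hτ
        refine ⟨a, fun y hy => ?_⟩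
        simp only [Function.comp]
        rcases ha y hy with ⟨q1, q2, q3⟩ | ⟨q1, q2, q3⟩
        · have := hfd _ _ q1 q2 q3
          rw [← neg_sub (f (φ y)), neg_sq]
          gcongr
        · have := hfd _ _ q1 q2 q3
          gcongr)
    rw [douglas _ (fc.comp hc) (comp_per fp h)] at hl
    have h4R : 0 ≤ Real.log (4 * R) := Real.log_nonneg (by linarith)
    have hu : 4 * H12seminormSq (f ∘ φ) ≤
        ENNReal.ofReal (4 * (C ^ 2 * (1 / 2 * Real.log (4 * R)))) := by
      rw [ENNReal.ofReal_mul (by norm_num), ENNReal.ofReal_mul (by positivity)]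
      simp only [ENNReal.ofReal_ofNat]
      gcongr
      exact (hC f hf).trans (by gcongr)
    have hfin := (ENNReal.ofReal_le_ofReal_iff (by positivity)).1 (hl.trans hu)
    have hpi := Real.pi_pos
    rw [div_le_iff₀ (by positivity)] at hfin
    nlinarith
  refine ⟨max R0 (1 / m), lt_of_lt_of_le (by positivity) (le_max_right _ _), fun x t ht htt => ?_⟩
  set M := max R0 (1 / m) with hM
  have hM0 : 0 < M := lt_of_lt_of_le (by positivity) (le_max_right _ _)
  have p1 : 0 < φ (x + t) - φ x := sub_pos.2 (hmono (by linarith))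
  have p2 : 0 < φ x - φ (x - t) := sub_pos.2 (hmono (by linarith))
  suffices hsuff : φ (x + t) - φ x ≤ M * (φ x - φ (x - t)) ∧
      φ x - φ (x - t) ≤ M * (φ (x + t) - φ x) by
    constructor
    · rw [div_le_div_iff₀ hM0 p2]; linarith [hsuff.2]
    · rw [div_le_iff₀ p2]; exact hsuff.1
  rcases lt_or_ge t t0 with htl | htg
  · -- small scales
    have gr : φ (x + 3 * t) ≤ φ x + 1 / 2 := hgap x (3 * t) (by linarith)
    have gl : φ x ≤ φ (x - 3 * t) + 1 / 2 := by
      have := hgap (x - 3 * t) (3 * t) (by linarith)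
      rwa [sub_add_cancel] at this
    have gr' : φ (x + t) ≤ φ (x + 3 * t) := hmono.monotone (by linarith)
    have gl' : φ (x - 3 * t) ≤ φ (x - t) := hmono.monotone (by linarith)
    constructor
    · by_contra hcon
      push Not at hcon
      have hRlt : M < (φ (x + t) - φ x) / (φ x - φ (x - t)) := by rwa [lt_div_iff₀ p2]
      have hRr : (φ (x + t) - φ x) / (φ x - φ (x - t)) * (φ x - φ (x - t)) = φ (x + t) - φ x :=
        div_mul_cancel₀ _ p2.ne'
      refine core (φ x) (φ x - φ (x - t)) _ p2 ((le_max_left _ _).trans hRlt.le)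
        (by rw [hRr]; linarith) t ht htl ?_
      intro τ hτ
      refine ⟨x - t, fun y hy => Or.inl ?_⟩
      rw [hRr]
      have i1 : φ (x - t) ≤ φ y := hmono.monotone hy.1.le
      have i2 : φ y ≤ φ x := hmono.monotone (by linarith [hy.2])
      have i3 : φ (x + t) ≤ φ (y + τ) := hmono.monotone (by linarith [hy.1, hτ.1])
      have i4 : φ (y + τ) ≤ φ (x + 3 * t) := hmono.monotone (by linarith [hy.2, hτ.2])
      rw [abs_of_nonpos (by linarith), abs_of_nonneg (by linarith)]
      refine ⟨?_, ?_, ?_⟩ <;> linarith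
    · by_contra hcon
      push Not at hcon
      have hRlt : M < (φ x - φ (x - t)) / (φ (x + t) - φ x) := by rwa [lt_div_iff₀ p1]
      have hRr : (φ x - φ (x - t)) / (φ (x + t) - φ x) * (φ (x + t) - φ x) = φ x - φ (x - t) :=
        div_mul_cancel₀ _ p1.ne'
      refine core (φ x) (φ (x + t) - φ x) _ p1 ((le_max_left _ _).trans hRlt.le)
        (by rw [hRr]; linarith) t ht htl ?_
      intro τ hτ
      refine ⟨x - τ, fun y hy => Or.inr ?_⟩
      rw [hRr]
      have i1 : φ (x - 3 * t) ≤ φ y := hmono.monotone (by linarith [hy.1, hτ.2])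
      have i2 : φ y ≤ φ (x - t) := hmono.monotone (by linarith [hy.2, hτ.1])
      have i3 : φ x ≤ φ (y + τ) := hmono.monotone (by linarith [hy.1])
      have i4 : φ (y + τ) ≤ φ (x + t) := hmono.monotone (by linarith [hy.2])
      rw [abs_of_nonneg (by linarith), abs_of_nonpos (by linarith)]
      refine ⟨?_, ?_, ?_⟩ <;> linarith
  · -- large scales
    have q1 : m ≤ φ (x + t) - φ x :=
      (hmin x).trans (sub_le_sub_right (hmono.monotone (by linarith)) _)
    have q2 : m ≤ φ x - φ (x - t) := by
      have := hmin (x - t)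
      have h2 : φ (x - t + t0) ≤ φ x := hmono.monotone (by linarith)
      linarith
    have q3 : φ (x + t) - φ (x - t) ≤ 1 := by
      have h2 : φ (x + t) ≤ φ (x - t + 1) := hmono.monotone (by linarith)
      rw [h.2.2] at h2
      linarith
    have hMm : 1 ≤ M * m := by
      have : 1 / m ≤ M := le_max_right _ _
      rwa [div_le_iff₀ hm] at this
    constructor
    · have : M * m ≤ M * (φ x - φ (x - t)) := by gcongr
      linarith
    · have : M * m ≤ M * (φ (x + t) - φ x) := by gcongr
      linarith


/-! ### Part 3: quasisymmetry implies boundedness -/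

lemma qs_mul {φ : ℝ → ℝ} (h : IsCircleLift φ) {M : ℝ} (hq : QSConst φ M) {x t : ℝ} (ht : 0 < t)
    (ht2 : t ≤ 1 / 2) : φ (x + 2 * t) - φ (x + t) ≤ M * (φ (x + t) - φ x) ∧
      φ (x + t) - φ x ≤ M * (φ (x + 2 * t) - φ (x + t)) := by
  obtain ⟨hM, hq⟩ := hq
  have h1 := hq (x + t) t ht ht2
  rw [show x + t + t = x + 2 * t by ring, show x + t - t = x by ring] at h1
  have p2 : 0 < φ (x + t) - φ x := sub_pos.2 (h.1 (by linarith))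
  constructor
  · have := h1.2
    rwa [div_le_iff₀ p2] at this
  · have := h1.1
    rw [div_le_div_iff₀ hM p2] at this
    linarith

lemma growth {φ : ℝ → ℝ} (h : IsCircleLift φ) {M : ℝ} (hq : QSConst φ M) (m : ℕ) :
    ∀ a d x t : ℝ, 0 < d → 2 ^ (m + 1) * d ≤ t → t ≤ 1 → x ≤ a → a + d ≤ x + t →
      (1 + 1 / M) ^ m * (φ (a + d) - φ a) ≤ φ (x + t) - φ x := by
  have hM := hq.1
  induction m with
  | zero =>
    intro a d x t hd h1 h2 h3 h4
    have := h.1.monotone h3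
    have := h.1.monotone h4
    simp only [pow_zero, one_mul]
    linarith
  | succ m ih =>
    intro a d x t hd h1 h2 h3 h4
    have hdt : 4 * d ≤ t := by
      have : (1:ℝ) ≤ 2 ^ m := one_le_pow₀ (by norm_num)
      rw [pow_succ, pow_succ] at h1
      nlinarith
    have h1' : 2 ^ (m + 1) * (2 * d) ≤ t := by rw [pow_succ] at h1; linarith
    rw [pow_succ, mul_assoc]
    rcases le_total (a + 2 * d) (x + t) with hr | hr
    · refine le_trans ?_ (ih a (2 * d) x t (by linarith) h1' h2 h3 hr)
      gcongr
      have := (qs_mul h hq (x := a) (t := d) hd (by linarith)).2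
      have h5 : (φ (a + d) - φ a) / M ≤ φ (a + 2 * d) - φ (a + d) := by
        rw [div_le_iff₀ hM]; linarith
      have e : (1 + 1 / M) * (φ (a + d) - φ a) = (φ (a + d) - φ a) + (φ (a + d) - φ a) / M := by ring
      rw [e]; linarith
    · have h6 := ih (a - d) (2 * d) x t (by linarith) h1' h2 (by linarith) (by linarith)
      rw [show a - d + 2 * d = a + d by ring] at h6
      refine le_trans ?_ h6
      gcongr
      have := (qs_mul h hq (x := a - d) (t := d) hd (by linarith)).1
      rw [show a - d + 2 * d = a + d by ring, sub_add_cancel] at this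
      have h5 : (φ (a + d) - φ a) / M ≤ φ a - φ (a - d) := by
        rw [div_le_iff₀ hM]; linarith
      have e : (1 + 1 / M) * (φ (a + d) - φ a) = (φ (a + d) - φ a) + (φ (a + d) - φ a) / M := by ring
      rw [e]; linarith

lemma jensen_sq {h : ℝ → ℝ} (hc : Continuous h) {a b : ℝ} (hab : a < b) :
    (∫ x in a..b, h x) ^ 2 ≤ (b - a) * ∫ x in a..b, h x ^ 2 := by
  have hba : 0 < b - a := sub_pos.2 hab
  set I := ∫ x in a..b, h x with hI
  have h0 : 0 ≤ ∫ x in a..b, (h x - I / (b - a)) ^ 2 :=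
    intervalIntegral.integral_nonneg hab.le (fun x _ => sq_nonneg _)
  have e : ∫ x in a..b, (h x - I / (b - a)) ^ 2 =
      (∫ x in a..b, h x ^ 2) - 2 * (I / (b - a)) * I + (I / (b - a)) ^ 2 * (b - a) := by
    have : ∀ x, (h x - I / (b - a)) ^ 2 = h x ^ 2 - 2 * (I / (b - a)) * h x + (I / (b - a)) ^ 2 := by
      intro x; ring
    simp_rw [this]
    rw [intervalIntegral.integral_add, intervalIntegral.integral_sub,
      intervalIntegral.integral_const_mul, intervalIntegral.integral_const, smul_eq_mul, ← hI]
    · ring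
    all_goals exact (by fun_prop : Continuous _).intervalIntegrable _ _
  rw [e] at h0
  have e2 : (∫ x in a..b, h x ^ 2) - 2 * (I / (b - a)) * I + (I / (b - a)) ^ 2 * (b - a) =
      ((b - a) * (∫ x in a..b, h x ^ 2) - I ^ 2) / (b - a) := by
    field_simp
    ring
  rw [e2, le_div_iff₀ hba] at h0
  linarith

lemma avg_diff {f : ℝ → ℝ} (hc : Continuous f) {a b c d : ℝ} (hab : a < b) (hcd : c < d) :
    ((b - a)⁻¹ * (∫ x in a..b, f x) - (d - c)⁻¹ * ∫ x in c..d, f x) ^ 2 * ((b - a) * (d - c)) ≤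
      ∫ u in a..b, ∫ v in c..d, (f u - f v) ^ 2 := by
  have hba : 0 < b - a := sub_pos.2 hab
  have hdc : 0 < d - c := sub_pos.2 hcd
  set A := (b - a)⁻¹ * ∫ x in a..b, f x with hA
  set B := (d - c)⁻¹ * ∫ x in c..d, f x with hB
  have hIA : ∫ x in a..b, f x = (b - a) * A := by rw [hA]; field_simp
  have hIB : ∫ x in c..d, f x = (d - c) * B := by rw [hB]; field_simp
  have h1 : ∀ u, (d - c) * (f u - B) ^ 2 ≤ ∫ v in c..d, (f u - f v) ^ 2 := by
    intro u
    have := jensen_sq (h := fun v => f u - f v) (by fun_prop) hcd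
    rw [intervalIntegral.integral_sub (by simp) (hc.intervalIntegrable _ _),
      intervalIntegral.integral_const, smul_eq_mul, hIB] at this
    have e : ((d - c) * f u - (d - c) * B) ^ 2 = (d - c) * ((d - c) * (f u - B) ^ 2) := by ring
    rw [e] at this
    exact le_of_mul_le_mul_left this hdc
  have h2 : (b - a) * (A - B) ^ 2 ≤ ∫ u in a..b, (f u - B) ^ 2 := by
    have := jensen_sq (h := fun u => f u - B) (by fun_prop) hab
    rw [intervalIntegral.integral_sub (hc.intervalIntegrable _ _) (by simp),
      intervalIntegral.integral_const, smul_eq_mul, hIA] at this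
    have e : ((b - a) * A - (b - a) * B) ^ 2 = (b - a) * ((b - a) * (A - B) ^ 2) := by ring
    rw [e] at this
    exact le_of_mul_le_mul_left this hba
  have h3 : ∫ u in a..b, (d - c) * (f u - B) ^ 2 ≤ ∫ u in a..b, ∫ v in c..d, (f u - f v) ^ 2 := by
    apply intervalIntegral.integral_mono_on hab.le
    · exact (by fun_prop : Continuous _).intervalIntegrable _ _
    · apply Continuous.intervalIntegrable
      apply intervalIntegral.continuous_parametric_intervalIntegral_of_continuous'
      fun_prop
    · intro u _
      exact h1 u
  rw [intervalIntegral.integral_const_mul] at h3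
  calc (A - B) ^ 2 * ((b - a) * (d - c)) = (d - c) * ((b - a) * (A - B) ^ 2) := by ring
    _ ≤ (d - c) * ∫ u in a..b, (f u - B) ^ 2 := by gcongr
    _ ≤ _ := h3

lemma double_ofReal {f : ℝ → ℝ} (hc : Continuous f) {a b c d : ℝ} (hab : a < b) (hcd : c < d) :
    ENNReal.ofReal (∫ u in a..b, ∫ v in c..d, (f u - f v) ^ 2) =
      ∫⁻ p in Ioc a b ×ˢ Ioc c d, ENNReal.ofReal ((f p.1 - f p.2) ^ 2) := by
  have hm : Measurable fun p : ℝ × ℝ => ENNReal.ofReal ((f p.1 - f p.2) ^ 2) := by fun_prop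
  rw [Measure.volume_eq_prod, setLIntegral_prod _ hm.aemeasurable,
    intervalIntegral.integral_of_le hab.le, ofReal_integral_eq_lintegral_ofReal]
  · apply lintegral_congr
    intro u
    rw [intervalIntegral.integral_of_le hcd.le, ofReal_integral_eq_lintegral_ofReal]
    · exact (by fun_prop : Continuous _).integrableOn_Ioc
    · exact Filter.Eventually.of_forall fun x => by positivity
  · apply Continuous.integrableOn_Ioc
    apply intervalIntegral.continuous_parametric_intervalIntegral_of_continuous'
    fun_prop
  · exact Filter.Eventually.of_forall fun x =>
      intervalIntegral.integral_nonneg hcd.le fun v _ => sq_nonneg _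

open Classical in
noncomputable def KF (φ f : ℝ → ℝ) (z p : ℝ × ℝ) : ENNReal :=
  if φ z.1 ≤ p.1 ∧ p.1 ≤ φ (z.1 + z.2) ∧ φ z.1 ≤ p.2 ∧ p.2 ≤ φ (z.1 + z.2) then
    ENNReal.ofReal ((f p.1 - f p.2) ^ 2) else 0

noncomputable def Be (φ f : ℝ → ℝ) (z : ℝ × ℝ) : ENNReal :=
  ENNReal.ofReal (1 / (φ (z.1 + z.2) - φ z.1) ^ 2) * ∫⁻ p, KF φ f z p

lemma KF_meas {φ f : ℝ → ℝ} (hφ : Continuous φ) (hf : Continuous f) :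
    Measurable fun q : (ℝ × ℝ) × (ℝ × ℝ) => KF φ f q.1 q.2 := by
  unfold KF
  apply Measurable.ite
  · apply IsClosed.measurableSet
    refine IsClosed.and ?_ (IsClosed.and ?_ (IsClosed.and ?_ ?_)) <;>
    exact isClosed_le (by fun_prop) (by fun_prop)
  · fun_prop
  · fun_prop

lemma Be_meas {φ f : ℝ → ℝ} (hφ : Continuous φ) (hf : Continuous f) : Measurable (Be φ f) := by
  unfold Be
  apply Measurable.mul
  · fun_prop
  · exact (KF_meas hφ hf).lintegral_prod_right'

noncomputable def avg (φ f : ℝ → ℝ) (x t : ℝ) : ℝ :=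
  (φ (x + t) - φ x)⁻¹ * ∫ u in φ x..φ (x + t), f u

lemma avg_Be {φ f : ℝ → ℝ} (hf : Continuous f) {a b c d x t k l : ℝ} (hab : a < b) (hcd : c < d)
    (h1 : φ x ≤ a) (h2 : b ≤ φ (x + t)) (h3 : φ x ≤ c) (h4 : d ≤ φ (x + t)) (hk : 0 ≤ k) (hl : 0 ≤ l)
    (hk' : φ (x + t) - φ x ≤ k * (b - a)) (hl' : φ (x + t) - φ x ≤ l * (d - c)) :
    ENNReal.ofReal (((b - a)⁻¹ * (∫ x in a..b, f x) - (d - c)⁻¹ * ∫ x in c..d, f x) ^ 2) ≤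
      ENNReal.ofReal (k * l) * Be φ f (x, t) := by
  have hba : 0 < b - a := sub_pos.2 hab
  have hdc : 0 < d - c := sub_pos.2 hcd
  have hL : 0 < φ (x + t) - φ x := by linarith
  have h := avg_diff hf hab hcd
  rw [← le_div_iff₀ (by positivity)] at h
  set J := ∫ u in a..b, ∫ v in c..d, (f u - f v) ^ 2 with hJ
  have hJ0 : 0 ≤ J := intervalIntegral.integral_nonneg hab.le fun u _ =>
    intervalIntegral.integral_nonneg hcd.le fun v _ => sq_nonneg _
  have h5 : J / ((b - a) * (d - c)) ≤ k * l * (1 / (φ (x + t) - φ x) ^ 2 * J) := by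
    have h6 : (φ (x + t) - φ x) ^ 2 ≤ k * l * ((b - a) * (d - c)) := by
      calc (φ (x + t) - φ x) ^ 2 = (φ (x + t) - φ x) * (φ (x + t) - φ x) := by ring
        _ ≤ (k * (b - a)) * (l * (d - c)) := by gcongr
        _ = _ := by ring
    rw [div_le_iff₀ (by positivity)]
    rw [show k * l * (1 / (φ (x + t) - φ x) ^ 2 * J) * ((b - a) * (d - c)) =
      (k * l * ((b - a) * (d - c))) * J / (φ (x + t) - φ x) ^ 2 by ring, le_div_iff₀ (by positivity),
      mul_comm]
    gcongr
  refine (ENNReal.ofReal_le_ofReal (h.trans h5)).trans ?_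
  rw [ENNReal.ofReal_mul (p := k * l) (by positivity),
    ENNReal.ofReal_mul (p := 1 / (φ (x + t) - φ x) ^ 2) (by positivity), hJ, double_ofReal hf hab hcd]
  unfold Be
  simp only
  refine mul_le_mul' le_rfl (mul_le_mul' le_rfl ?_)
  rw [← lintegral_indicator (measurableSet_Ioc.prod measurableSet_Ioc)]
  apply lintegral_mono
  intro p
  simp only
  rw [indicator_apply]
  split_ifs with hp
  · unfold KF
    rw [if_pos]
    obtain ⟨⟨p1, p2⟩, ⟨p3, p4⟩⟩ := hp
    simp only
    refine ⟨?_, ?_, ?_, ?_⟩ <;> linarith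
  · exact zero_le


lemma tele (N : ℕ) : ∀ s : ℕ → ℝ,
    (s N - s 0) ^ 2 ≤ ∑ j ∈ Finset.range N, 3 * (3 / 2) ^ j * (s j - s (j + 1)) ^ 2 := by
  induction N with
  | zero => intro s; simp
  | succ N ih =>
    intro s
    have h := ih (fun j => s (j + 1))
    simp only [zero_add] at h
    rw [Finset.sum_range_succ']
    have e : ∑ j ∈ Finset.range N, 3 * (3 / 2 : ℝ) ^ (j + 1) * (s (j + 1) - s (j + 1 + 1)) ^ 2 =
        3 / 2 * ∑ j ∈ Finset.range N, 3 * (3 / 2 : ℝ) ^ j * (s (j + 1) - s (j + 1 + 1)) ^ 2 := by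
      rw [Finset.mul_sum]
      refine Finset.sum_congr rfl fun j _ => ?_
      rw [pow_succ]; ring
    rw [e]
    simp only [pow_zero, mul_one, zero_add]
    nlinarith [sq_nonneg ((s (N + 1) - s 1) + 2 * (s 0 - s 1))]

lemma avg_tendsto {φ f : ℝ → ℝ} (h : IsCircleLift φ) (hf : Continuous f) (x : ℝ) {t : ℝ} (ht : 0 < t) :
    Filter.Tendsto (fun N : ℕ => avg φ f x (t / 2 ^ N)) Filter.atTop (nhds (f (φ x))) := by
  have hd : HasDerivAt (fun u => ∫ y in φ x..u, f y) (f (φ x)) (φ x) :=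
    intervalIntegral.integral_hasDerivAt_right (hf.intervalIntegrable _ _)
      (hf.stronglyMeasurableAtFilter _ _) hf.continuousAt
  rw [hasDerivAt_iff_tendsto_slope] at hd
  have h1 : Filter.Tendsto (fun N : ℕ => φ (x + t / 2 ^ N)) Filter.atTop (nhdsWithin (φ x) {φ x}ᶜ) := by
    rw [tendsto_nhdsWithin_iff]
    constructor
    · have h2 : Filter.Tendsto (fun N : ℕ => x + t / 2 ^ N) Filter.atTop (nhds (x + 0)) := by
        apply Filter.Tendsto.const_add
        have := (tendsto_pow_atTop_nhds_zero_of_lt_one (r := (1 / 2 : ℝ)) (by norm_num)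
          (by norm_num)).const_mul t
        simpa [div_eq_mul_inv] using this
      rw [add_zero] at h2
      exact ((lift_cont h).tendsto x).comp h2
    · refine Filter.Eventually.of_forall fun N => ?_
      have : 0 < t / 2 ^ N := by positivity
      exact (h.1 (by linarith : x < x + t / 2 ^ N)).ne'
  have h3 := hd.comp h1
  refine h3.congr fun N => ?_
  simp [slope, avg, Function.comp]

noncomputable def TT (φ f : ℝ → ℝ) (M x t : ℝ) : ENNReal :=
  ∑' j : ℕ, ENNReal.ofReal (3 * (3 / 2) ^ j * (1 + M)) * Be φ f (x, t / 2 ^ j)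

lemma tele_Be {φ f : ℝ → ℝ} (h : IsCircleLift φ) {M : ℝ} (hq : QSConst φ M) (hf : Continuous f)
    {x t : ℝ} (ht : 0 < t) (ht1 : t ≤ 1) :
    ENNReal.ofReal ((f (φ x) - avg φ f x t) ^ 2) ≤ TT φ f M x t := by
  have hM := hq.1
  set s : ℕ → ℝ := fun j => avg φ f x (t / 2 ^ j) with hs
  have hs0 : s 0 = avg φ f x t := by simp [hs]
  have hlim : Filter.Tendsto (fun N => ENNReal.ofReal ((s N - s 0) ^ 2)) Filter.atTop
      (nhds (ENNReal.ofReal ((f (φ x) - avg φ f x t) ^ 2))) := by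
    rw [← hs0]
    exact ENNReal.tendsto_ofReal (((avg_tendsto h hf x ht).sub_const _).pow 2)
  refine le_of_tendsto' hlim fun N => ?_
  refine (ENNReal.ofReal_le_ofReal (tele N s)).trans ?_
  rw [ENNReal.ofReal_sum_of_nonneg (fun j _ => by positivity)]
  refine le_trans ?_ (ENNReal.sum_le_tsum (Finset.range N))
  refine Finset.sum_le_sum fun j _ => ?_
  rw [ENNReal.ofReal_mul (by positivity), ENNReal.ofReal_mul (p := 3 * (3 / 2) ^ j) (by positivity),
    mul_assoc]
  gcongr
  have hτ : 0 < t / 2 ^ j := by positivity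
  have hτ1 : t / 2 ^ j ≤ 1 := by
    rw [div_le_one (by positivity)]
    exact ht1.trans (one_le_pow₀ (by norm_num))
  have hhalf : t / 2 ^ (j + 1) = (t / 2 ^ j) / 2 := by rw [pow_succ]; field_simp
  simp only [hs]
  rw [hhalf]
  set τ := t / 2 ^ j
  have q := qs_mul h hq (x := x) (t := τ / 2) (by linarith) (by linarith)
  rw [show x + 2 * (τ / 2) = x + τ by ring] at q
  have m1 : φ x < φ (x + τ / 2) := h.1 (by linarith)
  have m2 : φ (x + τ / 2) < φ (x + τ) := h.1 (by linarith)
  have := avg_Be (φ := φ) hf (x := x) (t := τ) (a := φ x) (b := φ (x + τ)) (c := φ x)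
    (d := φ (x + τ / 2)) (k := 1) (l := 1 + M)
    (by linarith) m1 le_rfl le_rfl le_rfl m2.le zero_le_one (by linarith) (by linarith)
    (by nlinarith [q.1])
  rw [one_mul] at this
  exact this

lemma pointwise {φ f : ℝ → ℝ} (h : IsCircleLift φ) {M : ℝ} (hq : QSConst φ M) (hf : Continuous f)
    {x t : ℝ} (ht : 0 < t) (ht1 : t ≤ 1 / 2) :
    ENNReal.ofReal ((f (φ (x + t)) - f (φ x)) ^ 2) ≤
      3 * (TT φ f M x t + TT φ f M (x + t) t + ENNReal.ofReal ((1 + M) * (1 + M)) * Be φ f (x, 2 * t)) := by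
  have hM := hq.1
  have h1 := tele_Be h hq hf (x := x) ht (by linarith)
  have h2 := tele_Be h hq hf (x := x + t) ht (by linarith)
  have q := qs_mul h hq (x := x) ht ht1
  have m1 : φ x < φ (x + t) := h.1 (by linarith)
  have m2 : φ (x + t) < φ (x + 2 * t) := h.1 (by linarith)
  have h3 := avg_Be (φ := φ) hf (x := x) (t := 2 * t) (a := φ x) (b := φ (x + t)) (c := φ (x + t))
    (d := φ (x + 2 * t)) (k := 1 + M) (l := 1 + M) m1 m2 le_rfl m2.le m1.le le_rfl (by linarith)
    (by linarith) (by nlinarith [q.1]) (by nlinarith [q.2])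
  have e : (φ (x + 2 * t) - φ (x + t))⁻¹ * ∫ u in φ (x + t)..φ (x + 2 * t), f u =
      avg φ f (x + t) t := by
    unfold avg
    rw [show x + t + t = x + 2 * t by ring]
  rw [e] at h3
  change ENNReal.ofReal ((avg φ f x t - _) ^ 2) ≤ _ at h3
  have h4 : (f (φ (x + t)) - f (φ x)) ^ 2 ≤ 3 * ((f (φ x) - avg φ f x t) ^ 2 +
      (f (φ (x + t)) - avg φ f (x + t) t) ^ 2 + (avg φ f x t - avg φ f (x + t) t) ^ 2) := by
    set p := f (φ x)
    set q := f (φ (x + t))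
    set a := avg φ f x t
    set b := avg φ f (x + t) t
    nlinarith [sq_nonneg ((q - b) + (p - a)), sq_nonneg ((q - b) + (a - b)), sq_nonneg ((a - b) + (p - a)),
      sq_nonneg ((q - b) - (a - b)), sq_nonneg ((q - b) + (p - a)), sq_nonneg ((a - b) + (p - a))]
  refine (ENNReal.ofReal_le_ofReal h4).trans ?_
  rw [ENNReal.ofReal_mul (by norm_num), ENNReal.ofReal_add (by positivity) (by positivity),
    ENNReal.ofReal_add (by positivity) (by positivity)]
  simp only [ENNReal.ofReal_ofNat]
  gcongr

lemma lint_scale (F : ℝ → ENNReal) (hF : Measurable F) {k : ℝ} (hk : 0 < k) :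
    ENNReal.ofReal k * ∫⁻ t, F (k * t) = ∫⁻ t, F t := by
  conv_rhs => rw [← Real.smul_map_volume_mul_left hk.ne']
  rw [lintegral_smul_measure, lintegral_map hF (by fun_prop), abs_of_pos hk, smul_eq_mul]

noncomputable def qq (φ f : ℝ → ℝ) (t : ℝ) : ENNReal := ∫⁻ x in Ioc (0:ℝ) 3, Be φ f (x, t)

noncomputable def QQ (φ f : ℝ → ℝ) : ENNReal :=
  ∫⁻ t in Ioc (0:ℝ) 1, ENNReal.ofReal (1 / t ^ 2) * qq φ f t

lemma qq_meas {φ f : ℝ → ℝ} (hφ : Continuous φ) (hf : Continuous f) : Measurable (qq φ f) := by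
  unfold qq
  exact (Be_meas hφ hf).lintegral_prod_left'

lemma QQ_scale {φ f : ℝ → ℝ} (hφ : Continuous φ) (hf : Continuous f) {k : ℝ} (hk : 0 < k)
    (hk2 : k ≤ 2) :
    ∫⁻ t in Ioc (0:ℝ) (1 / 2), ENNReal.ofReal (1 / t ^ 2) * qq φ f (k * t) ≤
      ENNReal.ofReal k * QQ φ f := by
  have hq := qq_meas hφ hf
  set F : ℝ → ENNReal := (Ioc (0:ℝ) 1).indicator fun t => ENNReal.ofReal (1 / t ^ 2) * qq φ f t with hF
  have hFm : Measurable F := by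
    apply Measurable.indicator _ measurableSet_Ioc
    fun_prop
  have hQ : QQ φ f = ∫⁻ t, F t := by
    unfold QQ
    rw [← lintegral_indicator measurableSet_Ioc]
  rw [hQ, ← lint_scale F hFm hk, ← mul_assoc, ← lintegral_const_mul _ (by fun_prop),
    ← lintegral_indicator measurableSet_Ioc]
  apply lintegral_mono
  intro t
  simp only
  rw [indicator_apply]
  split_ifs with ht
  · have hkt : k * t ∈ Ioc (0:ℝ) 1 := ⟨mul_pos hk ht.1, by nlinarith [ht.1, ht.2]⟩
    have ht0 := ht.1
    rw [hF, indicator_of_mem hkt, ← mul_assoc, ← ENNReal.ofReal_mul hk.le,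
      ← ENNReal.ofReal_mul (by positivity)]
    apply le_of_eq
    congr 2
    field_simp
  · exact zero_le


lemma shift_lint (h : ℝ → ENNReal) (a b s : ℝ) :
    ∫⁻ x in Ioc (a + s) (b + s), h (x - s) = ∫⁻ x in Ioc a b, h x := by
  rw [← lintegral_indicator measurableSet_Ioc, ← lintegral_indicator measurableSet_Ioc]
  conv_rhs => rw [← lintegral_sub_right_eq_self _ s]
  apply lintegral_congr
  intro x
  simp only [indicator_apply]
  have : x ∈ Ioc (a + s) (b + s) ↔ x - s ∈ Ioc a b := by
    simp only [mem_Ioc]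
    constructor <;> rintro ⟨h1, h2⟩ <;> constructor <;> linarith
  simp only [this]

lemma per_lint_n (h : ℝ → ENNReal) (hp : Function.Periodic h 1) (a : ℝ) (n : ℕ) :
    ∫⁻ x in Ioc a (a + n), h x = n * ∫⁻ x in Ioc (0:ℝ) 1, h x := by
  induction n with
  | zero => simp
  | succ n ih =>
    have e : Ioc a (a + (n + 1 : ℕ)) = Ioc a (a + n) ∪ Ioc (a + n) (a + n + 1) := by
      rw [Ioc_union_Ioc_eq_Ioc (by linarith [n.cast_nonneg (α := ℝ)]) (by linarith)]
      push_cast; ring_nf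
    rw [e, lintegral_union measurableSet_Ioc (Ioc_disjoint_Ioc_of_le le_rfl), ih, per_lint h hp]
    push_cast; ring

lemma De_half {g : ℝ → ℝ} (hp : Function.Periodic g 1) :
    De g = 2 * ∫⁻ t in Ioc (0:ℝ) (1 / 2), ∫⁻ x in Ioc (0:ℝ) 1,
      ENNReal.ofReal ((g (x + t) - g x) ^ 2 / Real.sin (Real.pi * t) ^ 2) := by
  unfold De
  set A : ℝ → ENNReal := fun t => ∫⁻ x in Ioc (0:ℝ) 1,
      ENNReal.ofReal ((g (x + t) - g x) ^ 2 / Real.sin (Real.pi * t) ^ 2) with hA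
  have hA1 : ∀ s, A (1 - s) = A s := by
    intro s
    simp only [hA]
    set G : ℝ → ENNReal := fun x =>
      ENNReal.ofReal ((g (x + s) - g x) ^ 2 / Real.sin (Real.pi * s) ^ 2) with hG
    have hGp : Function.Periodic G 1 := by
      intro x
      simp only [hG]
      rw [show x + 1 + s = x + s + 1 by ring, hp, hp]
    have e : ∀ x, ENNReal.ofReal ((g (x + (1 - s)) - g x) ^ 2 / Real.sin (Real.pi * (1 - s)) ^ 2) =
        G (x - s) := by
      intro x
      simp only [hG]
      rw [show x + (1 - s) = x - s + 1 by ring, hp, sub_add_cancel,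
        show Real.pi * (1 - s) = Real.pi - Real.pi * s by ring, Real.sin_pi_sub]
      congr 2
      ring
    simp_rw [e]
    rw [← per_lint (fun x => G (x - s)) _ s]
    · have := shift_lint G 0 1 s
      rw [zero_add, add_comm 1 s] at this
      exact this
    · intro x
      simp only
      rw [show x + 1 - s = x - s + 1 by ring, hGp]
  have e1 : Ioc (0:ℝ) 1 = Ioc (0:ℝ) (1 / 2) ∪ Ioc (1 / 2 : ℝ) 1 :=
    (Ioc_union_Ioc_eq_Ioc (by norm_num) (by norm_num)).symm
  change ∫⁻ t in Ioc (0:ℝ) 1, A t = 2 * ∫⁻ t in Ioc (0:ℝ) (1 / 2), A t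
  rw [e1, lintegral_union measurableSet_Ioc (Ioc_disjoint_Ioc_of_le le_rfl), two_mul]
  congr 1
  have e2 : ∫⁻ t in Ioc (1 / 2 : ℝ) 1, A t = ∫⁻ t in Ico (0 : ℝ) (1 / 2), A t := by
    rw [← lintegral_indicator measurableSet_Ioc, ← lintegral_indicator measurableSet_Ico,
      ← lintegral_sub_left_eq_self _ (1:ℝ)]
    apply lintegral_congr
    intro x
    simp only [indicator_apply, hA1]
    have : (1 - x ∈ Ioc (1 / 2 : ℝ) 1) ↔ x ∈ Ico (0:ℝ) (1 / 2) := by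
      simp only [mem_Ioc, mem_Ico]
      constructor <;> rintro ⟨h1, h2⟩ <;> constructor <;> linarith
    simp only [this]
  rw [e2]
  exact setLIntegral_congr Ico_ae_eq_Ioc

lemma sin_ge {t : ℝ} (h0 : 0 < t) (h1 : t ≤ 1 / 2) : t ≤ Real.sin (Real.pi * t) := by
  have := Real.mul_le_sin (x := Real.pi * t) (by positivity) (by nlinarith [Real.pi_pos])
  have e : 2 / Real.pi * (Real.pi * t) = 2 * t := by
    have := Real.pi_pos.ne'
    field_simp
  linarith

noncomputable def SS (φ f : ℝ → ℝ) (M t : ℝ) : ENNReal :=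
  ∑' j : ℕ, ENNReal.ofReal (3 * (3 / 2) ^ j * (1 + M)) * qq φ f (t / 2 ^ j)

lemma TT_int {φ f : ℝ → ℝ} (hφ : Continuous φ) (hf : Continuous f) (M t : ℝ) :
    ∫⁻ x in Ioc (0:ℝ) 3, TT φ f M x t = SS φ f M t := by
  have hB := Be_meas hφ hf
  unfold TT SS
  rw [lintegral_tsum]
  · refine tsum_congr fun j => ?_
    rw [lintegral_const_mul _ (by fun_prop)]
    rfl
  · intro j
    fun_prop

lemma TT_meas {φ f : ℝ → ℝ} (hφ : Continuous φ) (hf : Continuous f) (M t : ℝ) :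
    Measurable fun x => TT φ f M x t := by
  have hB := Be_meas hφ hf
  unfold TT
  fun_prop

lemma inner_bound {φ f : ℝ → ℝ} (h : IsCircleLift φ) {M : ℝ} (hq : QSConst φ M) (hf : Continuous f)
    {t : ℝ} (ht : 0 < t) (ht1 : t ≤ 1 / 2) :
    ∫⁻ x in Ioc (0:ℝ) 1, ENNReal.ofReal
      (((f ∘ φ) (x + t) - (f ∘ φ) x) ^ 2 / Real.sin (Real.pi * t) ^ 2) ≤
    ENNReal.ofReal (1 / t ^ 2) * (3 * (SS φ f M t + SS φ f M t +
      ENNReal.ofReal ((1 + M) * (1 + M)) * qq φ f (2 * t))) := by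
  have hφ := lift_cont h
  have hB := Be_meas hφ hf
  have hT := TT_meas hφ hf M t
  have hs := sin_ge ht ht1
  calc _ ≤ ∫⁻ x in Ioc (0:ℝ) 1, ENNReal.ofReal (1 / t ^ 2) * (3 * (TT φ f M x t + TT φ f M (x + t) t +
        ENNReal.ofReal ((1 + M) * (1 + M)) * Be φ f (x, 2 * t))) := by
        apply lintegral_mono
        intro x
        simp only [Function.comp]
        refine le_trans ?_ (mul_le_mul' le_rfl (pointwise h hq hf ht ht1))
        rw [← ENNReal.ofReal_mul (by positivity)]
        apply ENNReal.ofReal_le_ofReal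
        rw [div_eq_mul_one_div, mul_comm]
        gcongr
    _ = ENNReal.ofReal (1 / t ^ 2) * (3 * ((∫⁻ x in Ioc (0:ℝ) 1, TT φ f M x t) +
          (∫⁻ x in Ioc (0:ℝ) 1, TT φ f M (x + t) t) +
        ENNReal.ofReal ((1 + M) * (1 + M)) * ∫⁻ x in Ioc (0:ℝ) 1, Be φ f (x, 2 * t))) := by
        have hT2 : Measurable fun x => TT φ f M (x + t) t := hT.comp (by fun_prop)
        rw [lintegral_const_mul _ (by fun_prop), lintegral_const_mul _ (by fun_prop),
          lintegral_add_left (by fun_prop), lintegral_add_left (by fun_prop),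
          lintegral_const_mul _ (by fun_prop)]
    _ ≤ _ := by
        refine mul_le_mul' le_rfl (mul_le_mul' le_rfl (add_le_add (add_le_add ?_ ?_)
          (mul_le_mul' le_rfl ?_)))
        · rw [← TT_int hφ hf]
          exact lintegral_mono_set (Ioc_subset_Ioc_right (by norm_num))
        · rw [← TT_int hφ hf]
          have := shift_lint (fun x => TT φ f M (x + t) t) 0 1 t
          rw [← this]
          simp only [sub_add_cancel]
          exact lintegral_mono_set (Ioc_subset_Ioc (by linarith) (by linarith))
        · exact lintegral_mono_set (Ioc_subset_Ioc_right (by norm_num))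

lemma SS_bound {φ f : ℝ → ℝ} (h : IsCircleLift φ) {M : ℝ} (hM : 0 < M) (hf : Continuous f) :
    ∫⁻ t in Ioc (0:ℝ) (1 / 2), ENNReal.ofReal (1 / t ^ 2) * SS φ f M t ≤
      ENNReal.ofReal (3 * (1 + M)) * (1 - ENNReal.ofReal (3 / 4))⁻¹ * QQ φ f := by
  have hφ := lift_cont h
  have hq := qq_meas hφ hf
  unfold SS
  simp_rw [← ENNReal.tsum_mul_left]
  rw [lintegral_tsum (fun j => by fun_prop), ← ENNReal.tsum_geometric, ← ENNReal.tsum_mul_left,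
    ← ENNReal.tsum_mul_right]
  refine ENNReal.tsum_le_tsum fun j => ?_
  have e : ∀ t, ENNReal.ofReal (1 / t ^ 2) * (ENNReal.ofReal (3 * (3 / 2) ^ j * (1 + M)) *
      qq φ f (t / 2 ^ j)) = ENNReal.ofReal (3 * (3 / 2) ^ j * (1 + M)) *
        (ENNReal.ofReal (1 / t ^ 2) * qq φ f ((1 / 2) ^ j * t)) := by
    intro t
    rw [show (1 / 2 : ℝ) ^ j * t = t / 2 ^ j by rw [one_div, inv_pow]; field_simp]
    ring
  simp_rw [e]
  rw [lintegral_const_mul _ (by fun_prop)]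
  refine (mul_le_mul' le_rfl (QQ_scale hφ hf (k := (1 / 2) ^ j) (by positivity) ?_)).trans ?_
  · exact (pow_le_one₀ (by norm_num) (by norm_num)).trans (by norm_num)
  · rw [← mul_assoc, ← ENNReal.ofReal_mul (by positivity), ← ENNReal.ofReal_pow (by norm_num),
      ← ENNReal.ofReal_mul (by positivity)]
    apply le_of_eq
    congr 2
    rw [show (3 / 4 : ℝ) = 3 / 2 * (1 / 2) by norm_num, mul_pow]
    ring

noncomputable def K1 (M : ℝ) : ENNReal :=
  2 * (3 * (ENNReal.ofReal (3 * (1 + M)) * (1 - ENNReal.ofReal (3 / 4))⁻¹ +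
    ENNReal.ofReal (3 * (1 + M)) * (1 - ENNReal.ofReal (3 / 4))⁻¹ +
    ENNReal.ofReal ((1 + M) * (1 + M)) * ENNReal.ofReal 2))

lemma geom_fin {r : ℝ} (hr : r < 1) : (1 - ENNReal.ofReal r)⁻¹ ≠ ⊤ := by
  rw [ENNReal.inv_ne_top]
  have : ENNReal.ofReal r < 1 := by rwa [ENNReal.ofReal_lt_one]
  exact (tsub_pos_of_lt this).ne'

lemma K1_fin (M : ℝ) : K1 M ≠ ⊤ := by
  have := geom_fin (r := 3 / 4) (by norm_num)
  unfold K1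
  finiteness

lemma De_le_QQ {φ f : ℝ → ℝ} (h : IsCircleLift φ) {M : ℝ} (hq : QSConst φ M) (hf : Continuous f)
    (hp : Function.Periodic f 1) : De (f ∘ φ) ≤ K1 M * QQ φ f := by
  have hφ := lift_cont h
  have hqm := qq_meas hφ hf
  have hSm : Measurable (SS φ f M) := by
    unfold SS
    fun_prop
  rw [De_half (comp_per hp h)]
  unfold K1
  rw [mul_assoc]
  refine mul_le_mul' le_rfl ?_
  calc _ ≤ ∫⁻ t in Ioc (0:ℝ) (1 / 2), ENNReal.ofReal (1 / t ^ 2) * (3 * (SS φ f M t + SS φ f M t +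
      ENNReal.ofReal ((1 + M) * (1 + M)) * qq φ f (2 * t))) :=
        setLIntegral_mono' measurableSet_Ioc fun t ht => inner_bound h hq hf ht.1 ht.2
    _ = ∫⁻ t in Ioc (0:ℝ) (1 / 2), 3 * (ENNReal.ofReal (1 / t ^ 2) * SS φ f M t +
        ENNReal.ofReal (1 / t ^ 2) * SS φ f M t +
        ENNReal.ofReal ((1 + M) * (1 + M)) * (ENNReal.ofReal (1 / t ^ 2) * qq φ f (2 * t))) := by
        apply lintegral_congr
        intro t
        ring
    _ = 3 * ((∫⁻ t in Ioc (0:ℝ) (1 / 2), ENNReal.ofReal (1 / t ^ 2) * SS φ f M t) +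
        (∫⁻ t in Ioc (0:ℝ) (1 / 2), ENNReal.ofReal (1 / t ^ 2) * SS φ f M t) +
        ENNReal.ofReal ((1 + M) * (1 + M)) *
          ∫⁻ t in Ioc (0:ℝ) (1 / 2), ENNReal.ofReal (1 / t ^ 2) * qq φ f (2 * t)) := by
        rw [lintegral_const_mul _ (by fun_prop), lintegral_add_left (by fun_prop),
          lintegral_add_left (by fun_prop), lintegral_const_mul _ (by fun_prop)]
    _ ≤ 3 * (ENNReal.ofReal (3 * (1 + M)) * (1 - ENNReal.ofReal (3 / 4))⁻¹ * QQ φ f +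
        ENNReal.ofReal (3 * (1 + M)) * (1 - ENNReal.ofReal (3 / 4))⁻¹ * QQ φ f +
        ENNReal.ofReal ((1 + M) * (1 + M)) * (ENNReal.ofReal 2 * QQ φ f)) := by
        refine mul_le_mul' le_rfl (add_le_add (add_le_add ?_ ?_) (mul_le_mul' le_rfl ?_))
        · exact SS_bound h hq.1 hf
        · exact SS_bound h hq.1 hf
        · exact QQ_scale hφ hf (by norm_num) le_rfl
    _ = _ := by ring


noncomputable def WW (φ : ℝ → ℝ) (z : ℝ × ℝ) : ENNReal :=
  ENNReal.ofReal (1 / z.2 ^ 2) * ENNReal.ofReal (1 / (φ (z.1 + z.2) - φ z.1) ^ 2)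

noncomputable def cK (M : ℝ) : ENNReal :=
  ENNReal.ofReal (2 * (1 + 1 / M) ^ 2) * (1 - ENNReal.ofReal (((1 + 1 / M) ^ 2)⁻¹))⁻¹

lemma cK_fin {M : ℝ} (hM : 0 < M) : cK M ≠ ⊤ := by
  have h1 : 0 < 1 / M := by positivity
  have := geom_fin (r := ((1 + 1 / M) ^ 2)⁻¹) (inv_lt_one_of_one_lt₀ (by nlinarith))
  unfold cK
  finiteness

lemma WW_bound {φ : ℝ → ℝ} (h : IsCircleLift φ) {M : ℝ} (hq : QSConst φ M) {a b x t : ℝ}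
    (hab : a < b) (ht : 0 < t) (ht1 : t ≤ 1) (hx : x ≤ a) (hxt : b ≤ x + t) :
    ∃ n : ℕ, (x, t) ∈ Icc (a - 2 ^ (n + 1) * (b - a)) a ×ˢ
        Ico (2 ^ n * (b - a)) (2 ^ (n + 1) * (b - a)) ∧
      WW φ (x, t) ≤ ENNReal.ofReal (1 / (2 ^ n * (b - a)) ^ 2 *
        ((1 + 1 / M) ^ 2 / (((1 + 1 / M) ^ n) ^ 2 * (φ b - φ a) ^ 2))) := by
  have hM := hq.1
  have hd : 0 < b - a := sub_pos.2 hab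
  obtain ⟨n, h1, h2⟩ := exists_nat_pow_near (x := t / (b - a)) (y := 2)
    (by rw [le_div_iff₀ hd]; linarith) (by norm_num)
  rw [le_div_iff₀ hd] at h1
  rw [div_lt_iff₀ hd] at h2
  refine ⟨n, ⟨⟨by simp only; linarith, hx⟩, h1, h2⟩, ?_⟩
  have hV : 0 < φ b - φ a := sub_pos.2 (h.1 hab)
  have hM1 : 0 < 1 / M := by positivity
  have hL : (1 + 1 / M) ^ n * (φ b - φ a) ≤ (1 + 1 / M) * (φ (x + t) - φ x) := by
    have m1 := h.1.monotone hx
    have m2 := h.1.monotone hxt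
    rcases n with _ | m
    · rw [pow_zero]
      nlinarith
    · have := growth h hq m a (b - a) x t hd h1 ht1 hx (by linarith)
      rw [show a + (b - a) = b by ring] at this
      rw [pow_succ, mul_comm ((1 + 1 / M) ^ m), mul_assoc]
      gcongr
  have hL0 : 0 < φ (x + t) - φ x := sub_pos.2 (h.1 (by linarith))
  unfold WW
  simp only
  rw [← ENNReal.ofReal_mul (by positivity)]
  apply ENNReal.ofReal_le_ofReal
  refine mul_le_mul ?_ ?_ (by positivity) (by positivity)
  · gcongr
  · rw [div_le_div_iff₀ (by positivity) (by positivity), one_mul, ← mul_pow, ← mul_pow]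
    gcongr

open Classical in
lemma kernel {φ : ℝ → ℝ} (h : IsCircleLift φ) {M : ℝ} (hq : QSConst φ M) {a b : ℝ} (hab : a < b) :
    ∫⁻ z : ℝ × ℝ, (if 0 < z.2 ∧ z.2 ≤ 1 ∧ z.1 ≤ a ∧ b ≤ z.1 + z.2 then WW φ z else 0) ≤
      cK M * ENNReal.ofReal (1 / (φ b - φ a) ^ 2) := by
  have hM := hq.1
  have hd : 0 < b - a := sub_pos.2 hab
  have hV : 0 < φ b - φ a := sub_pos.2 (h.1 hab)
  set c : ℕ → ENNReal := fun n => ENNReal.ofReal (1 / (2 ^ n * (b - a)) ^ 2 *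
        ((1 + 1 / M) ^ 2 / (((1 + 1 / M) ^ n) ^ 2 * (φ b - φ a) ^ 2))) with hc
  set S : ℕ → Set (ℝ × ℝ) := fun n => Icc (a - 2 ^ (n + 1) * (b - a)) a ×ˢ
        Ico (2 ^ n * (b - a)) (2 ^ (n + 1) * (b - a)) with hS
  have hSm : ∀ n, MeasurableSet (S n) := fun n => measurableSet_Icc.prod measurableSet_Ico
  calc _ ≤ ∫⁻ z : ℝ × ℝ, ∑' n, (S n).indicator (fun _ => c n) z := by
        apply lintegral_mono
        rintro ⟨x, t⟩
        simp only
        split_ifs with hz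
        · obtain ⟨n, hn, hw⟩ := WW_bound h hq hab hz.1 hz.2.1 hz.2.2.1 hz.2.2.2
          refine hw.trans (le_trans ?_ (ENNReal.le_tsum n))
          rw [indicator_of_mem hn]
        · exact zero_le
    _ = ∑' n, c n * volume (S n) := by
        rw [lintegral_tsum fun n => (measurable_const.indicator (hSm n)).aemeasurable]
        refine tsum_congr fun n => ?_
        rw [lintegral_indicator_const (hSm n)]
    _ = ∑' n, ENNReal.ofReal (2 * (1 + 1 / M) ^ 2) * ENNReal.ofReal (((1 + 1 / M) ^ 2)⁻¹) ^ n *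
          ENNReal.ofReal (1 / (φ b - φ a) ^ 2) := by
        refine tsum_congr fun n => ?_
        simp only [hS, hc]
        rw [Measure.volume_eq_prod, Measure.prod_prod, Real.volume_Icc, Real.volume_Ico,
          ← ENNReal.ofReal_mul (by rw [sub_sub_cancel]; positivity), ← ENNReal.ofReal_mul (by positivity),
          ← ENNReal.ofReal_pow (by positivity), ← ENNReal.ofReal_mul (by positivity),
          ← ENNReal.ofReal_mul (by positivity)]
        congr 1
        have : 0 < 1 + 1 / M := by positivity
        set l := 1 + 1 / M
        set d := b - a
        rw [inv_pow, ← pow_mul, ← pow_mul, mul_comm n 2, pow_succ]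
        field_simp
        ring
    _ = _ := by
        rw [ENNReal.tsum_mul_right, ENNReal.tsum_mul_left, ENNReal.tsum_geometric, cK]

noncomputable def RR (φ : ℝ → ℝ) : Set (ℝ × ℝ) :=
  {p | p.1 ∈ Ioc (φ 0) (φ 0 + 4) ∧ p.2 - p.1 ∈ Ioc (-2 : ℝ) 1}

lemma ker_p {φ f : ℝ → ℝ} (h : IsCircleLift φ) {M : ℝ} (hq : QSConst φ M) (p : ℝ × ℝ) :
    ∫⁻ z in Ioc (0:ℝ) 3 ×ˢ Ioc (0:ℝ) 1, WW φ z * KF φ f z p ≤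
      cK M * (RR φ).indicator (fun p => ENNReal.ofReal ((f p.1 - f p.2) ^ 2 / (p.1 - p.2) ^ 2)) p := by
  classical
  obtain ⟨u, v⟩ := p
  rw [← lintegral_indicator (measurableSet_Ioc.prod measurableSet_Ioc)]
  by_cases huv : u = v
  · subst huv
    have : ∀ z, KF φ f z (u, u) = 0 := by intro z; simp [KF]
    simp [this]
  by_cases hR : (u, v) ∈ RR φ
  · rw [indicator_of_mem hR]
    simp only
    obtain ⟨a, ha⟩ := h.2.1 (min u v)
    obtain ⟨b, hb⟩ := h.2.1 (max u v)
    have hab : a < b := by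
      rw [← h.1.lt_iff_lt, ha, hb]
      exact min_lt_max.2 huv
    have e : (φ b - φ a) ^ 2 = (u - v) ^ 2 := by
      rw [ha, hb, max_sub_min_eq_abs, sq_abs]; ring
    calc _ ≤ ∫⁻ z : ℝ × ℝ, (if 0 < z.2 ∧ z.2 ≤ 1 ∧ z.1 ≤ a ∧ b ≤ z.1 + z.2 then WW φ z else 0) *
          ENNReal.ofReal ((f u - f v) ^ 2) := by
          apply lintegral_mono
          rintro ⟨x, t⟩
          simp only
          rw [indicator_apply]
          split_ifs with h1 h2 h2
          · unfold KF
            split_ifs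
            · exact le_rfl
            · simp
          · unfold KF
            rw [if_neg]
            · simp
            · simp only
              rintro ⟨q1, q2, q3, q4⟩
              apply h2
              refine ⟨h1.2.1, h1.2.2, ?_, ?_⟩
              · rw [← h.1.le_iff_le, ha]
                exact le_min q1 q3
              · rw [← h.1.le_iff_le, hb]
                exact max_le q2 q4
          · exact zero_le
          · exact zero_le
      _ ≤ cK M * ENNReal.ofReal (1 / (φ b - φ a) ^ 2) * ENNReal.ofReal ((f u - f v) ^ 2) := by
          rw [lintegral_mul_const' _ _ ENNReal.ofReal_ne_top]
          exact mul_le_mul' (kernel h hq hab) le_rfl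
      _ = _ := by
          rw [mul_assoc, ← ENNReal.ofReal_mul (by positivity), e]
          congr 2
          ring
  · have : ∀ z, (Ioc (0:ℝ) 3 ×ˢ Ioc (0:ℝ) 1).indicator (fun z => WW φ z * KF φ f z (u, v)) z = 0 := by
      rintro ⟨x, t⟩
      rw [indicator_apply]
      split_ifs with h1
      · unfold KF
        rw [if_neg]
        · simp
        · simp only
          rintro ⟨q1, q2, q3, q4⟩
          apply hR
          obtain ⟨⟨x1, x2⟩, t1, t2⟩ := h1
          simp only at x1 x2 t1 t2
          have m1 := h.1 x1
          have m2 := h.1.monotone (by linarith : x + t ≤ 0 + 1 + 1 + 1 + 1)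
          have m3 := h.1.monotone (by linarith : x + t ≤ x + 1)
          simp only [h.2.2] at m2 m3
          refine ⟨⟨?_, ?_⟩, ?_, ?_⟩ <;> simp only <;> linarith
      · rfl
    simp [this]

lemma per_zero {f : ℝ → ℝ} (hp : Function.Periodic f 1) {w : ℝ} (hw : Real.sin (Real.pi * w) = 0)
    (u : ℝ) : f (u + w) = f u := by
  rw [Real.sin_eq_zero_iff] at hw
  obtain ⟨n, hn⟩ := hw
  have : w = n := by
    have := Real.pi_pos.ne'
    apply mul_left_cancel₀ this
    linarith
  rw [this]
  have := hp.int_mul n u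
  simpa using this

lemma RR_int {φ f : ℝ → ℝ} (hf : Continuous f) (hp : Function.Periodic f 1) :
    ∫⁻ p, (RR φ).indicator (fun p => ENNReal.ofReal ((f p.1 - f p.2) ^ 2 / (p.1 - p.2) ^ 2)) p ≤
      ENNReal.ofReal (Real.pi ^ 2) * (4 * (3 * De f)) := by
  have hRm : MeasurableSet (RR φ) := by
    apply MeasurableSet.inter
    · exact measurable_fst measurableSet_Ioc
    · exact (measurable_snd.sub measurable_fst) measurableSet_Ioc
  set G : ℝ → ℝ → ENNReal := fun u w =>
    ENNReal.ofReal ((f (u + w) - f u) ^ 2 / Real.sin (Real.pi * w) ^ 2) with hG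
  have hGm : Measurable (Function.uncurry G) := by
    simp only [hG, Function.uncurry_def]
    fun_prop
  calc _ = ∫⁻ u, ∫⁻ v, (RR φ).indicator
        (fun p => ENNReal.ofReal ((f p.1 - f p.2) ^ 2 / (p.1 - p.2) ^ 2)) (u, v) := by
        rw [Measure.volume_eq_prod, lintegral_prod]
        apply Measurable.aemeasurable
        apply Measurable.indicator _ hRm
        fun_prop
    _ ≤ ∫⁻ u, (Ioc (φ 0) (φ 0 + 4)).indicator (fun u => ∫⁻ w in Ioc (-2 : ℝ) 1,
          ENNReal.ofReal (Real.pi ^ 2) * G u w) u := by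
        apply lintegral_mono
        intro u
        simp only
        by_cases hu : u ∈ Ioc (φ 0) (φ 0 + 4)
        · rw [indicator_of_mem hu, ← lintegral_add_left_eq_self _ u,
            ← lintegral_indicator measurableSet_Ioc]
          apply lintegral_mono
          intro w
          simp only
          by_cases hw : w ∈ Ioc (-2 : ℝ) 1
          · rw [indicator_of_mem hw, indicator_of_mem (by exact ⟨hu, by simpa using hw⟩)]
            simp only [hG]
            rw [← ENNReal.ofReal_mul (by positivity)]
            apply ENNReal.ofReal_le_ofReal
            by_cases hs : Real.sin (Real.pi * w) = 0
            · rw [per_zero hp hs u]; simp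
            · have hw0 : w ≠ 0 := by rintro rfl; simp at hs
              have hs2 : Real.sin (Real.pi * w) ^ 2 ≤ Real.pi ^ 2 * w ^ 2 := by
                rw [← mul_pow]
                exact sq_le_sq.2 Real.abs_sin_le_abs
              have : 0 < Real.sin (Real.pi * w) ^ 2 := by positivity
              rw [show u - (u + w) = - w by ring, neg_sq, ← mul_div_assoc,
                div_le_div_iff₀ (by positivity) (by positivity)]
              nlinarith [mul_le_mul_of_nonneg_left hs2 (sq_nonneg (f (u + w) - f u))]
          · rw [indicator_of_notMem hw, indicator_of_notMem]
            rintro ⟨-, q⟩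
            exact hw (by simpa using q)
        · rw [indicator_of_notMem hu]
          have : ∀ v, (RR φ).indicator
              (fun p => ENNReal.ofReal ((f p.1 - f p.2) ^ 2 / (p.1 - p.2) ^ 2)) (u, v) = 0 := by
            intro v
            rw [indicator_of_notMem]
            rintro ⟨q, -⟩
            exact hu q
          simp [this]
    _ = ENNReal.ofReal (Real.pi ^ 2) * ∫⁻ u in Ioc (φ 0) (φ 0 + 4), ∫⁻ w in Ioc (-2 : ℝ) 1, G u w := by
        rw [lintegral_indicator measurableSet_Ioc, ← lintegral_const_mul' _ _ ENNReal.ofReal_ne_top]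
        apply lintegral_congr
        intro u
        rw [lintegral_const_mul' _ _ ENNReal.ofReal_ne_top]
    _ = ENNReal.ofReal (Real.pi ^ 2) * ∫⁻ w in Ioc (-2 : ℝ) 1, ∫⁻ u in Ioc (φ 0) (φ 0 + 4), G u w := by
        rw [lintegral_lintegral_swap hGm.aemeasurable]
    _ = ENNReal.ofReal (Real.pi ^ 2) * ∫⁻ w in Ioc (-2 : ℝ) 1, 4 * ∫⁻ u in Ioc (0 : ℝ) 1, G u w := by
        congr 1
        apply lintegral_congr
        intro w
        have := per_lint_n (fun u => G u w) (fun u => by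
          simp only [hG]
          rw [show u + 1 + w = u + w + 1 by ring, hp, hp]) (φ 0) 4
        exact_mod_cast this
    _ = ENNReal.ofReal (Real.pi ^ 2) * (4 * ∫⁻ w in Ioc (-2 : ℝ) 1, ∫⁻ u in Ioc (0 : ℝ) 1, G u w) := by
        rw [lintegral_const_mul' _ _ (by simp)]
    _ = _ := by
        congr 2
        have := per_lint_n (fun w => ∫⁻ u in Ioc (0 : ℝ) 1, G u w) (fun w => by
          simp only [hG]
          refine lintegral_congr fun u => ?_
          rw [← add_assoc, hp, mul_add, mul_one, Real.sin_add_pi, neg_sq]) (-2) 3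
        rw [show (-2 : ℝ) + (3 : ℕ) = 1 by norm_num] at this
        exact_mod_cast this

lemma QQ_le {φ f : ℝ → ℝ} (h : IsCircleLift φ) {M : ℝ} (hq : QSConst φ M) (hf : Continuous f)
    (hp : Function.Periodic f 1) :
    QQ φ f ≤ cK M * (ENNReal.ofReal (Real.pi ^ 2) * (4 * (3 * De f))) := by
  have hφ := lift_cont h
  have hB := Be_meas hφ hf
  have hK := KF_meas hφ hf
  have hW : Measurable (WW φ) := by unfold WW; fun_prop
  calc QQ φ f = ∫⁻ t in Ioc (0:ℝ) 1, ∫⁻ x in Ioc (0:ℝ) 3,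
        ENNReal.ofReal (1 / t ^ 2) * Be φ f (x, t) := by
        unfold QQ qq
        refine lintegral_congr fun t => ?_
        rw [lintegral_const_mul' _ _ ENNReal.ofReal_ne_top]
    _ = ∫⁻ z in Ioc (0:ℝ) 3 ×ˢ Ioc (0:ℝ) 1, ENNReal.ofReal (1 / z.2 ^ 2) * Be φ f z := by
        rw [Measure.volume_eq_prod, setLIntegral_prod_symm]
        apply Measurable.aemeasurable
        fun_prop
    _ = ∫⁻ z in Ioc (0:ℝ) 3 ×ˢ Ioc (0:ℝ) 1, ∫⁻ p, WW φ z * KF φ f z p := by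
        refine lintegral_congr fun z => ?_
        rw [lintegral_const_mul' _ _ (by unfold WW; finiteness), WW, Be, mul_assoc]
    _ = ∫⁻ p, ∫⁻ z in Ioc (0:ℝ) 3 ×ˢ Ioc (0:ℝ) 1, WW φ z * KF φ f z p := by
        rw [lintegral_lintegral_swap]
        apply Measurable.aemeasurable
        exact (hW.comp measurable_fst).mul hK
    _ ≤ ∫⁻ p, cK M *
        (RR φ).indicator (fun p => ENNReal.ofReal ((f p.1 - f p.2) ^ 2 / (p.1 - p.2) ^ 2)) p :=
        lintegral_mono fun p => ker_p h hq p
    _ ≤ _ := by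
        rw [lintegral_const_mul' _ _ (cK_fin hq.1)]
        exact mul_le_mul' le_rfl (RR_int hf hp)

lemma qs_imp_bounded {φ : ℝ → ℝ} (h : IsCircleLift φ) {M : ℝ} (hq : QSConst φ M) :
    ∃ C : ℝ, 0 < C ∧ ∀ f : ℝ → ℝ, IsRealTrigPoly f →
      H12seminormSq (f ∘ φ) ≤ ENNReal.ofReal (C ^ 2) * H12seminormSq f := by
  set K : ENNReal := K1 M * (cK M * (ENNReal.ofReal (Real.pi ^ 2) * (4 * 3))) with hK
  have hKf : K ≠ ⊤ := by
    have := K1_fin M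
    have := cK_fin hq.1
    rw [hK]
    finiteness
  refine ⟨K.toReal + 1, by positivity, fun f hf => ?_⟩
  obtain ⟨hc, hp⟩ := trig_cont_per hf
  have h1 : De (f ∘ φ) ≤ K * De f := by
    refine (De_le_QQ h hq hc hp).trans ((mul_le_mul' le_rfl (QQ_le h hq hc hp)).trans (le_of_eq ?_))
    rw [hK]
    ring
  rw [douglas _ (hc.comp (lift_cont h)) (comp_per hp h), douglas _ hc hp, mul_left_comm] at h1
  have h2 : H12seminormSq (f ∘ φ) ≤ K * H12seminormSq f :=
    (ENNReal.mul_le_mul_iff_right (by norm_num) (by norm_num)).1 h1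
  refine h2.trans (mul_le_mul' ?_ le_rfl)
  rw [← ENNReal.ofReal_toReal hKf]
  apply ENNReal.ofReal_le_ofReal
  rw [ENNReal.toReal_ofReal (by positivity)]
  nlinarith [ENNReal.toReal_nonneg (a := K)]

/-- **Nag–Sullivan boundedness theorem.**  An orientation-preserving homeomorphism `φ` of
the circle, with lift `φ̃`, is quasisymmetric if and only if there is a constant `C > 0`
such that `‖f ∘ φ̃‖_{1/2} ≤ C ‖f‖_{1/2}` for every real trigonometric polynomial `f` of
period `1`; i.e. the composition operator `V_φ` is bounded on `H^{1/2}(S¹,ℝ)/ℝ` iff `φ` is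
quasisymmetric. -/
theorem nag_sullivan_boundedness (φt : ℝ → ℝ) (hlift : IsCircleLift φt) :
    (∃ M : ℝ, QSConst φt M) ↔
    ∃ C : ℝ, 0 < C ∧ ∀ f : ℝ → ℝ, IsRealTrigPoly f →
      H12seminormSq (f ∘ φt) ≤ ENNReal.ofReal (C ^ 2) * H12seminormSq f := by
  exact ⟨fun ⟨_, hM⟩ => qs_imp_bounded hlift hM, fun ⟨_, _, hC⟩ => bounded_imp_qs hlift hC⟩
end

section
/- Quasisymmetric homeomorphisms act by symplectomorphisms on H^{1/2}: let φ̃ : ℝ → ℝ be an increasing homeomorphism with φ̃(x+1) = φ̃(x) + 1 whose induced circle homeomorphism φ is quasisymmetric. Then for all real-valued trigonometric polynomials f, g of period 1, the series Σ_{n∈ℤ} n · (f∘φ̃)^(n) · conj((g∘φ̃)^(n)) converges absolutely and Σ_{n∈ℤ} n · (f∘φ̃)^(n) · conj((g∘φ̃)^(n)) = Σ_{n∈ℤ} n · f̂(n) · conj(ĝ(n)); that is, the symplectic form Ω(u, v) = −i Σ_{n∈ℤ} n u_n conj(v_n) satisfies Ω(f∘φ̃, g∘φ̃) = Ω(f,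 g). -/
open Complex MeasureTheory

open Filter Topology

lemma qs_parseval (F G : ℝ → ℂ) (hF : Continuous F) (hG : Continuous G)
    (pF : Function.Periodic F 1) (pG : Function.Periodic G 1) :
    HasSum (fun n : ℤ => fourierCoeff1 F n * (starRingEnd ℂ) (fourierCoeff1 G n))
      (∫ x in (0:ℝ)..1, F x * (starRingEnd ℂ) (G x)) := by
  have : Fact ((0:ℝ) < 1) := ⟨one_pos⟩
  let F' : C(AddCircle (1:ℝ), ℂ) := ⟨pF.lift, continuous_coinduced_dom.mpr hF⟩
  let G' : C(AddCircle (1:ℝ), ℂ) := ⟨pG.lift, continuous_coinduced_dom.mpr hG⟩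
  have key : ∀ (H : ℝ → ℂ) (pH : Function.Periodic H 1) (n : ℤ),
      fourierCoeff (pH.lift : AddCircle (1:ℝ) → ℂ) n = fourierCoeff1 H n := by
    intro H pH n
    rw [fourierCoeff_eq_intervalIntegral _ n 0, fourierCoeff1]
    simp only [zero_add, div_one, one_smul]
    apply intervalIntegral.integral_congr
    intro x _
    simp only [fourier_coe_apply, smul_eq_mul, Function.Periodic.lift_coe]
    rw [mul_comm]
    congr 2
    push_cast
    ring
  have h := (fourierBasis (T := (1:ℝ))).hasSum_inner_mul_inner
    (ContinuousMap.toLp (E := ℂ) 2 AddCircle.haarAddCircle ℂ G')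
    (ContinuousMap.toLp (E := ℂ) 2 AddCircle.haarAddCircle ℂ F')
  rw [MeasureTheory.ContinuousMap.inner_toLp] at h
  have e : ∫ x : AddCircle (1:ℝ), F' x * (starRingEnd ℂ) (G' x) ∂AddCircle.haarAddCircle
      = ∫ x in (0:ℝ)..1, F x * (starRingEnd ℂ) (G x) := by
    rw [AddCircle.integral_haarAddCircle, ← AddCircle.intervalIntegral_preimage 1 0]
    simp [F', G']
  rw [e] at h
  refine h.congr_fun (fun n => ?_)
  have h1 := fourierBasis_repr (T := (1:ℝ))
    (ContinuousMap.toLp (E := ℂ) 2 AddCircle.haarAddCircle ℂ F') n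
  have h2 := fourierBasis_repr (T := (1:ℝ))
    (ContinuousMap.toLp (E := ℂ) 2 AddCircle.haarAddCircle ℂ G') n
  rw [fourierCoeff_toLp, HilbertBasis.repr_apply_apply] at h1 h2
  rw [← inner_conj_symm (𝕜 := ℂ) _ (fourierBasis n), h1, h2, mul_comm]
  rw [← key F pF, ← key G pG]
  rfl

lemma qs_coeff_shift (F : ℝ → ℂ) (pF : Function.Periodic F 1) (t : ℝ) (n : ℤ) :
    fourierCoeff1 (fun x => F (x + t)) n =
      Complex.exp (Complex.I * ((2 * Real.pi * n * t : ℝ) : ℂ)) * fourierCoeff1 F n := by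
  let P : ℝ → ℂ := fun x => F x * Complex.exp (-(2 * Real.pi * Complex.I * n * x))
  have pP : Function.Periodic P 1 := by
    intro x
    simp only [P, pF x]
    congr 1
    rw [Complex.exp_eq_exp_iff_exists_int]
    refine ⟨-n, ?_⟩
    push_cast; ring
  have h1 : ∫ x in (0:ℝ)..1, P (x + t) = ∫ x in (0:ℝ)..1, P x := by
    rw [intervalIntegral.integral_comp_add_right]
    have := pP.intervalIntegral_add_eq t 0
    rw [zero_add] at this
    rw [← this]; congr 1 <;> ring
  unfold fourierCoeff1
  change _ = _ * ∫ x in (0:ℝ)..1, P x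
  rw [← h1, ← intervalIntegral.integral_const_mul]
  apply intervalIntegral.integral_congr
  intro x _
  simp only [P]
  rw [mul_left_comm, ← Complex.exp_add]
  congr 2
  push_cast; ring

lemma qs_int_shift (G : ℝ → ℝ) (hG : Continuous G) (c : ℝ) (h : ∀ x, G (x + 1) = G x + c)
    (t : ℝ) : ∫ x in (0:ℝ)..1, (G (x + t) - G x) = c * t := by
  let P : ℝ → ℝ := fun x => G x - c * x
  have cP : Continuous P := by fun_prop
  have pP : Function.Periodic P 1 := by
    intro x; simp only [P, h]; ring
  have h1 : ∫ x in (0:ℝ)..1, P (x + t) = ∫ x in (0:ℝ)..1, P x := by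
    rw [intervalIntegral.integral_comp_add_right]
    have := pP.intervalIntegral_add_eq t 0
    rw [zero_add] at this
    rw [← this]; congr 1 <;> ring
  have h2 : ∀ x, G (x + t) - G x = (P (x + t) - P x) + c * t := by
    intro x; simp only [P]; ring
  simp_rw [h2]
  rw [intervalIntegral.integral_add, intervalIntegral.integral_sub, h1]
  · simp
  all_goals apply Continuous.intervalIntegrable; fun_prop

lemma qs_holder (φ : ℝ → ℝ) (hl : IsCircleLift φ) (hq : ∃ M, QSConst φ M) :
    ∃ C α : ℝ, 0 < α ∧ 0 ≤ C ∧ ∀ x t, 0 < t → t ≤ 1 → φ (x + t) - φ x ≤ C * t ^ α := by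
  obtain ⟨hm, -, h1⟩ := hl
  obtain ⟨M, hM, hq⟩ := hq
  set q := M / (M + 1) with hqd
  have q0 : 0 < q := by positivity
  have q1 : q < 1 := by rw [hqd, div_lt_one (by linarith)]; linarith
  have half : ∀ x t, 0 < t → t ≤ 1/2 → φ (x + t) - φ x ≤ q * (φ (x + 2 * t) - φ x) := by
    intro x t ht ht'
    have a := (hq (x + t) t ht ht').1
    have e1 : x + t + t = x + 2 * t := by ring
    have e2 : x + t - t = x := by ring
    rw [e1, e2] at a
    have p : 0 < φ (x + t) - φ x := sub_pos.mpr (hm (by linarith))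
    rw [div_le_div_iff₀ hM p] at a
    rw [hqd, div_mul_eq_mul_div, le_div_iff₀ (by linarith)]
    nlinarith
  set α := - Real.logb 2 q with hα
  have α0 : 0 < α := by
    rw [hα]; have := Real.logb_neg (b := 2) (by norm_num) q0 q1; linarith
  have q2 : q * 2 ^ α = 1 := by
    rw [hα, Real.rpow_neg (by norm_num), Real.rpow_logb (by norm_num) (by norm_num) q0]
    field_simp
  refine ⟨2 ^ α, α, α0, by positivity, ?_⟩
  have main : ∀ k : ℕ, ∀ x t, (1/2:ℝ) ^ (k + 1) < t → t ≤ 1 → φ (x + t) - φ x ≤ 2 ^ α * t ^ α := by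
    intro k
    induction k with
    | zero =>
      intro x t ht ht'
      have t0 : 0 < t := by norm_num at ht; linarith
      have : φ (x + t) ≤ φ (x + 1) := hm.monotone (by linarith)
      rw [h1] at this
      rw [← Real.mul_rpow (by norm_num) t0.le]
      have : 1 ≤ (2 * t) ^ α := Real.one_le_rpow (by norm_num at ht; linarith) α0.le
      linarith
    | succ k ih =>
      intro x t ht ht'
      have t0 : 0 < t := lt_trans (by positivity) ht
      rcases le_or_gt t (1/2) with h | h
      · have i := ih x (2 * t) (by rw [pow_succ] at ht; linarith) (by linarith)
        rw [Real.mul_rpow (by norm_num) t0.le] at i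
        calc _ ≤ q * (φ (x + 2 * t) - φ x) := half x t t0 h
          _ ≤ q * (2 ^ α * (2 ^ α * t ^ α)) := by gcongr
          _ = (q * 2 ^ α) * (2 ^ α * t ^ α) := by ring
          _ = _ := by rw [q2, one_mul]
      · have : φ (x + t) ≤ φ (x + 1) := hm.monotone (by linarith)
        rw [h1] at this
        rw [← Real.mul_rpow (by norm_num) t0.le]
        have : 1 ≤ (2 * t) ^ α := Real.one_le_rpow (by linarith) α0.le
        linarith
  intro x t ht ht'
  obtain ⟨k, hk⟩ := exists_pow_lt_of_lt_one ht (by norm_num : (1/2:ℝ) < 1)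
  refine main k x t (lt_of_le_of_lt ?_ hk) ht'
  exact pow_le_pow_of_le_one (by norm_num) (by norm_num) (by omega)

lemma qs_cont (φ : ℝ → ℝ) (hl : IsCircleLift φ) : Continuous φ :=
  hl.1.monotone.continuous_of_surjective hl.2.1

lemma qs_sq (φ : ℝ → ℝ) (hl : IsCircleLift φ) (C α : ℝ)
    (hC : ∀ x t, 0 < t → t ≤ 1 → φ (x + t) - φ x ≤ C * t ^ α) (t : ℝ) (t0 : 0 < t) (t1 : t ≤ 1) :
    ∫ x in (0:ℝ)..1, (φ (x + t) - φ x) ^ 2 ≤ C * t ^ α * t := by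
  have hc := qs_cont φ hl
  have := qs_int_shift φ hc 1 hl.2.2 t
  rw [one_mul] at this
  conv_rhs => enter [2]; rw [← this]
  rw [← intervalIntegral.integral_const_mul]
  apply intervalIntegral.integral_mono_on (by norm_num)
  · apply Continuous.intervalIntegrable; fun_prop
  · apply Continuous.intervalIntegrable; fun_prop
  · intro x _
    have p : 0 < φ (x + t) - φ x := sub_pos.mpr (hl.1 (by linarith))
    nlinarith [hC x t t0 t1]

lemma qs_trig (f : ℝ → ℝ) (hf : IsRealTrigPoly f) : ContDiff ℝ 1 f ∧ Function.Periodic f 1 := by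
  obtain ⟨N, c, -, -, h⟩ := hf
  constructor
  · have : f = fun x : ℝ => (∑ n ∈ Finset.Icc (-N) N,
      c n * Complex.exp (2 * Real.pi * Complex.I * n * x)).re := by
      ext x; rw [← h x]; simp
    rw [this]
    refine Complex.reCLM.contDiff.comp ?_
    refine ContDiff.sum fun n _ => contDiff_const.mul (ContDiff.cexp ?_)
    exact contDiff_const.mul Complex.ofRealCLM.contDiff
  · intro x
    have : ((f (x + 1) : ℝ) : ℂ) = f x := by
      rw [h, h]
      refine Finset.sum_congr rfl fun n _ => ?_
      congr 1
      rw [Complex.exp_eq_exp_iff_exists_int]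
      refine ⟨n, ?_⟩
      push_cast; ring
    exact_mod_cast this

lemma qs_lip (f : ℝ → ℝ) (hf : ContDiff ℝ 1 f) (pf : Function.Periodic f 1) :
    ∃ L, 0 ≤ L ∧ (∀ x, |deriv f x| ≤ L) ∧ ∀ x y, |f y - f x| ≤ L * |y - x| := by
  have hd : Continuous (deriv f) := hf.continuous_deriv le_rfl
  have pd : Function.Periodic (deriv f) 1 := by
    intro x
    have : (fun y => f (y + 1)) = f := funext pf
    rw [← deriv_comp_add_const, this]
  obtain ⟨L, hL⟩ := (pd.isBounded_of_continuous one_ne_zero hd).exists_norm_le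
  have hb : ∀ x, |deriv f x| ≤ L := fun x => hL _ ⟨x, rfl⟩
  refine ⟨L, (abs_nonneg _).trans (hb 0), hb, fun x y => ?_⟩
  exact Convex.norm_image_sub_le_of_norm_deriv_le (s := Set.univ)
    (fun z _ => (hf.differentiable one_ne_zero) z) (fun z _ => hb z) convex_univ trivial trivial

/-- the main quadratic approximation -/
lemma qs_quad (f g : ℝ → ℝ) (hf : ContDiff ℝ 1 f) (pf : Function.Periodic f 1)
    (hg : ContDiff ℝ 1 g) (pg : Function.Periodic g 1) :
    ∃ (H : ℝ → ℝ) (c K : ℝ), Continuous H ∧ (∀ x, H (x + 1) = H x + c) ∧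
      c = ∫ x in (0:ℝ)..1, deriv f x * g x ∧ 0 ≤ K ∧
      ∀ a b, a ≤ b → |(f b - f a) * g a - (H b - H a)| ≤ K * (b - a) ^ 2 := by
  obtain ⟨A, A0, hA, -⟩ := qs_lip f hf pf
  obtain ⟨B, B0, -, hB⟩ := qs_lip g hg pg
  have hd : Continuous (deriv f) := hf.continuous_deriv le_rfl
  have pd : Function.Periodic (deriv f) 1 := by
    intro x
    have : (fun y => f (y + 1)) = f := funext pf
    rw [← deriv_comp_add_const, this]
  have hh : Continuous fun x => deriv f x * g x := hd.mul hg.continuous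
  have ph : Function.Periodic (fun x => deriv f x * g x) 1 := by
    intro x; simp only [pd x, pg x]
  have ii : ∀ a b, IntervalIntegrable (fun x => deriv f x * g x) volume a b :=
    fun a b => hh.intervalIntegrable a b
  have dH : ∀ x, HasDerivAt (fun x => ∫ s in (0:ℝ)..x, deriv f s * g s) (deriv f x * g x) x :=
    fun x => hh.integral_hasStrictDerivAt 0 x |>.hasDerivAt
  refine ⟨fun x => ∫ s in (0:ℝ)..x, deriv f s * g s, _, A * B, ?_, ?_, rfl, by positivity, ?_⟩
  · exact continuous_iff_continuousAt.mpr fun x => (dH x).continuousAt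
  · intro x
    have := ph.intervalIntegral_add_eq x 0
    rw [zero_add] at this
    rw [← this, intervalIntegral.integral_add_adjacent_intervals (ii _ _) (ii _ _)]
  · intro a b hab
    have := Convex.norm_image_sub_le_of_norm_hasDerivWithin_le (s := Set.Icc a b) (x := a) (y := b)
      (f := fun s => f s * g a - ∫ s in (0:ℝ)..s, deriv f s * g s)
      (f' := fun s => deriv f s * g a - deriv f s * g s) (C := A * (B * (b - a)))
      (fun s _ => ((((hf.differentiable one_ne_zero) s).hasDerivAt.mul_const _).sub
        (dH s)).hasDerivWithinAt) ?_ (convex_Icc a b) ⟨le_rfl, hab⟩ ⟨hab, le_rfl⟩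
    · rw [Real.norm_eq_abs, Real.norm_eq_abs, abs_of_nonneg (sub_nonneg.mpr hab)] at this
      calc _ = _ := by congr 1; ring
        _ ≤ _ := this
        _ = _ := by ring
    · intro s hs
      rw [← mul_sub, norm_mul]
      refine mul_le_mul (hA s) ((hB s a).trans ?_) (norm_nonneg _) A0
      gcongr
      rw [abs_le]; constructor <;> linarith [hs.1, hs.2]

lemma qs_coeff_diff (F : ℝ → ℂ) (hF : Continuous F) (pF : Function.Periodic F 1) (t : ℝ) (n : ℤ) :
    fourierCoeff1 (fun x => F (x + t) - F x) n =
      (Complex.exp (Complex.I * ((2 * Real.pi * n * t : ℝ) : ℂ)) - 1) * fourierCoeff1 F n := by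
  rw [sub_mul, one_mul, ← qs_coeff_shift F pF]
  unfold fourierCoeff1
  rw [← intervalIntegral.integral_sub]
  · apply intervalIntegral.integral_congr
    intro x _
    simp only [sub_mul]
  all_goals apply Continuous.intervalIntegrable; fun_prop

lemma qs_summable (φ : ℝ → ℝ) (hl : IsCircleLift φ) (hq : ∃ M, QSConst φ M)
    (f : ℝ → ℝ) (hf : ContDiff ℝ 1 f) (pf : Function.Periodic f 1) :
    Summable fun n : ℤ => |(n:ℝ)| * ‖fourierCoeff1 (fun x => ((f ∘ φ) x : ℂ)) n‖ ^ 2 := by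
  obtain ⟨C, α, α0, C0, hC⟩ := qs_holder φ hl hq
  obtain ⟨L, L0, -, hL⟩ := qs_lip f hf pf
  have hc := qs_cont φ hl
  have cf := hf.continuous
  set F : ℝ → ℂ := fun x => ((f ∘ φ) x : ℂ) with hF
  have cF : Continuous F := Complex.continuous_ofReal.comp (cf.comp hc)
  have pF : Function.Periodic F 1 := by
    intro x; simp only [hF, Function.comp, hl.2.2 x, pf (φ x)]
  let T : ℕ → ℝ := fun m => 1 / (2 * ((m:ℝ) + 1))
  have T0 : ∀ m, 0 < T m := fun m => by simp only [T]; positivity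
  have T1 : ∀ m, T m ≤ 1 := fun m => by
    simp only [T]; rw [div_le_one (by positivity)]
    have : (0:ℝ) ≤ m := by positivity
    linarith
  let a : ℕ × ℤ → ℝ := fun p =>
    ‖Complex.exp (Complex.I * ((2 * Real.pi * p.2 * T p.1 : ℝ) : ℂ)) - 1‖ ^ 2 *
      ‖fourierCoeff1 F p.2‖ ^ 2
  have a0 : ∀ p, 0 ≤ a p := fun p => by simp only [a]; positivity
  have hs : ∀ m, HasSum (fun n => a (m, n)) (∫ x in (0:ℝ)..1, (f (φ (x + T m)) - f (φ x)) ^ 2) := by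
    intro m
    have cD : Continuous fun x => F (x + T m) - F x := by fun_prop
    have pD : Function.Periodic (fun x => F (x + T m) - F x) 1 := by
      intro x
      have : x + 1 + T m = (x + T m) + 1 := by ring
      simp only [this, pF _]
    have h := qs_parseval _ _ cD cD pD pD
    have e : (∫ x in (0:ℝ)..1, (F (x + T m) - F x) * (starRingEnd ℂ) (F (x + T m) - F x)) =
      ((∫ x in (0:ℝ)..1, (f (φ (x + T m)) - f (φ x)) ^ 2 : ℝ) : ℂ) := by
      rw [← intervalIntegral.integral_ofReal]
      apply intervalIntegral.integral_congr
      intro x _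
      simp only [hF, Function.comp, map_sub, Complex.conj_ofReal]
      push_cast; ring
    rw [e] at h
    have h' := Complex.hasSum_re h
    rw [Complex.ofReal_re] at h'
    refine h'.congr_fun fun n => ?_
    rw [qs_coeff_diff F cF pF, Complex.mul_conj, Complex.ofReal_re, Complex.normSq_eq_norm_sq,
      norm_mul, mul_pow]
  have hI : ∀ m, ∫ x in (0:ℝ)..1, (f (φ (x + T m)) - f (φ x)) ^ 2 ≤
      L ^ 2 * C * (1 / ((m:ℝ) + 1) ^ (1 + α)) := by
    intro m
    calc _ ≤ ∫ x in (0:ℝ)..1, L ^ 2 * (φ (x + T m) - φ x) ^ 2 := by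
          apply intervalIntegral.integral_mono_on (by norm_num)
          · apply Continuous.intervalIntegrable; fun_prop
          · apply Continuous.intervalIntegrable; fun_prop
          · intro x _
            rw [← mul_pow, sq_le_sq, abs_mul, abs_of_nonneg L0]
            exact hL _ _
      _ = L ^ 2 * ∫ x in (0:ℝ)..1, (φ (x + T m) - φ x) ^ 2 := by
          rw [intervalIntegral.integral_const_mul]
      _ ≤ L ^ 2 * (C * T m ^ α * T m) := by
          gcongr
          exact qs_sq φ hl C α hC (T m) (T0 m) (T1 m)
      _ = L ^ 2 * C * (T m ^ (1 + α)) := by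
          rw [Real.rpow_add (T0 m), Real.rpow_one]; ring
      _ ≤ _ := by
          have e : 1 / ((m:ℝ) + 1) ^ (1 + α) = (1 / ((m:ℝ) + 1)) ^ (1 + α) := by
            rw [Real.div_rpow (by norm_num) (by positivity), Real.one_rpow]
          rw [e]
          gcongr
          · simp only [T]
            gcongr
            have : (0:ℝ) ≤ m := by positivity
            linarith
  have sa : Summable a := by
    rw [summable_prod_of_nonneg a0]
    refine ⟨fun m => (hs m).summable, ?_⟩
    have : Summable fun m : ℕ => L ^ 2 * C * (1 / ((m:ℝ) + 1) ^ (1 + α)) := by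
      apply Summable.mul_left
      have := (summable_nat_add_iff 1).mpr (Real.summable_one_div_nat_rpow.mpr
        (by linarith : 1 < 1 + α))
      simpa using this
    refine Summable.of_nonneg_of_le (fun m => tsum_nonneg fun n => a0 _) (fun m => ?_) this
    rw [(hs m).tsum_eq]; exact hI m
  have sa' : Summable fun p : ℤ × ℕ => a (p.2, p.1) := (Equiv.prodComm ℤ ℕ).summable_iff.mpr sa
  obtain ⟨r1, r2⟩ := (summable_prod_of_nonneg (fun p => a0 _)).mp sa'
  refine Summable.of_nonneg_of_le (fun n => by positivity) (fun n => ?_) r2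
  refine le_trans ?_ ((r1 n).sum_le_tsum (Finset.Ico (n.natAbs - 1) (2 * n.natAbs - 1))
    (fun m _ => a0 _))
  rcases eq_or_ne n 0 with rfl | hn
  · simp
  have hk : 1 ≤ n.natAbs := Int.natAbs_pos.mpr hn
  have hkn : |(n:ℝ)| = n.natAbs := by rw [Nat.cast_natAbs]; simp
  have : |(n:ℝ)| * ‖fourierCoeff1 F n‖ ^ 2 =
      ∑ m ∈ Finset.Ico (n.natAbs - 1) (2 * n.natAbs - 1), ‖fourierCoeff1 F n‖ ^ 2 := by
    rw [Finset.sum_const, Nat.card_Ico, nsmul_eq_mul, hkn]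
    congr 2; omega
  rw [this]
  apply Finset.sum_le_sum
  intro m hm
  rw [Finset.mem_Ico] at hm
  simp only [a]
  apply le_mul_of_one_le_left (by positivity)
  rw [Complex.norm_exp_I_mul_ofReal_sub_one, one_le_sq_iff_one_le_abs, Real.norm_eq_abs, abs_abs,
    abs_mul]
  have e1 : (n.natAbs : ℝ) ≤ m + 1 := by exact_mod_cast (by omega : n.natAbs ≤ m + 1)
  have e2 : (m + 1 : ℝ) ≤ 2 * n.natAbs := by exact_mod_cast (by omega : m + 1 ≤ 2 * n.natAbs)
  have m0 : (0:ℝ) < m + 1 := by positivity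
  set y := 2 * Real.pi * n * T m / 2 with hy
  have ey : |y| = Real.pi / 2 * (n.natAbs / (m + 1)) := by
    have : y = Real.pi / 2 * (n / (m + 1)) := by simp only [hy, T]; field_simp
    rw [this, abs_mul, abs_div (n:ℝ), hkn, abs_of_pos m0, abs_of_pos (by positivity)]
  have q1 : (n.natAbs : ℝ) / (m + 1) ≤ 1 := by rw [div_le_one m0]; exact e1
  have q2 : 1 / 2 ≤ (n.natAbs : ℝ) / (m + 1) := by rw [le_div_iff₀ m0]; linarith
  have pp := Real.pi_pos
  have j := Real.mul_abs_le_abs_sin (x := y) (by rw [ey]; nlinarith)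
  have : 2 / Real.pi * |y| = (n.natAbs : ℝ) / (m + 1) := by rw [ey]; field_simp
  rw [this] at j
  rw [abs_of_pos (by norm_num : (0:ℝ) < 2)]
  linarith

lemma qs_main (φ : ℝ → ℝ) (hl : IsCircleLift φ) (hq : ∃ M, QSConst φ M)
    (f g : ℝ → ℝ) (hf : ContDiff ℝ 1 f) (pf : Function.Periodic f 1)
    (hg : ContDiff ℝ 1 g) (pg : Function.Periodic g 1) :
    Summable (fun n : ℤ => ‖(n : ℂ) * fourierCoeff1 (fun x => ((f ∘ φ) x : ℂ)) n *
      (starRingEnd ℂ) (fourierCoeff1 (fun x => ((g ∘ φ) x : ℂ)) n)‖) ∧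
    2 * Real.pi * Complex.I * ∑' n : ℤ, (n : ℂ) * fourierCoeff1 (fun x => ((f ∘ φ) x : ℂ)) n *
        (starRingEnd ℂ) (fourierCoeff1 (fun x => ((g ∘ φ) x : ℂ)) n) =
      ((∫ x in (0:ℝ)..1, deriv f x * g x : ℝ) : ℂ) := by
  have sf := qs_summable φ hl hq f hf pf
  have sg := qs_summable φ hl hq g hg pg
  obtain ⟨C, α, α0, C0, hC⟩ := qs_holder φ hl hq
  obtain ⟨H, c, K, cH, pH, hcd, K0, hK⟩ := qs_quad f g hf pf hg pg
  have hc := qs_cont φ hl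
  have cf := hf.continuous
  have cg := hg.continuous
  rw [← hcd]
  set F : ℝ → ℂ := fun x => ((f ∘ φ) x : ℂ) with hF
  set G : ℝ → ℂ := fun x => ((g ∘ φ) x : ℂ) with hG
  have cF : Continuous F := Complex.continuous_ofReal.comp (cf.comp hc)
  have cG : Continuous G := Complex.continuous_ofReal.comp (cg.comp hc)
  have pF : Function.Periodic F 1 := by
    intro x; simp only [hF, Function.comp, hl.2.2 x, pf (φ x)]
  have pG : Function.Periodic G 1 := by
    intro x; simp only [hG, Function.comp, hl.2.2 x, pg (φ x)]
  have S : Summable (fun n : ℤ => ‖(n : ℂ) * fourierCoeff1 F n *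
      (starRingEnd ℂ) (fourierCoeff1 G n)‖) := by
    refine Summable.of_nonneg_of_le (fun n => norm_nonneg _) (fun n => ?_) (sf.add sg)
    rw [norm_mul, norm_mul, RCLike.norm_conj, Complex.norm_intCast]
    have := abs_nonneg (n:ℝ)
    nlinarith [sq_nonneg (‖fourierCoeff1 F n‖ - ‖fourierCoeff1 G n‖),
      mul_nonneg this (sq_nonneg (‖fourierCoeff1 F n‖ - ‖fourierCoeff1 G n‖)),
      mul_nonneg this (sq_nonneg ‖fourierCoeff1 F n‖),
      mul_nonneg this (sq_nonneg ‖fourierCoeff1 G n‖)]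
  refine ⟨S, ?_⟩
  let D : ℝ → ℤ → ℂ := fun t n =>
    (Complex.exp (Complex.I * ((2 * Real.pi * n * t : ℝ) : ℂ)) - 1) / t *
      (fourierCoeff1 F n * (starRingEnd ℂ) (fourierCoeff1 G n))
  have lim1 : Tendsto (fun t => ∑' n, D t n) (𝓝[>] (0:ℝ))
      (𝓝 (∑' n : ℤ, 2 * Real.pi * Complex.I * ((n : ℂ) * fourierCoeff1 F n *
        (starRingEnd ℂ) (fourierCoeff1 G n)))) := by
    refine tendsto_tsum_of_dominated_convergence (S.mul_left (2 * Real.pi)) ?_ ?_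
    · intro n
      have d : HasDerivAt (fun t : ℝ => Complex.exp (Complex.I * ((2 * Real.pi * n * t : ℝ) : ℂ)))
          (2 * Real.pi * Complex.I * n) 0 := by
        have h0 : HasDerivAt (fun t : ℝ => Complex.I * ((2 * Real.pi * n * t : ℝ) : ℂ))
            (Complex.I * ((2 * Real.pi * n * 1 : ℝ) : ℂ)) 0 :=
          (((hasDerivAt_id (0:ℝ)).const_mul (2 * Real.pi * n)).ofReal_comp).const_mul _
        convert h0.cexp using 1
        simp; ring
      have d2 := (hasDerivAt_iff_tendsto_slope_zero.mp d).mono_left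
        (nhdsWithin_mono (0:ℝ)
          (show Set.Ioi (0:ℝ) ⊆ {0}ᶜ from fun t (ht : 0 < t) => ht.ne'))
      have d3 := d2.mul_const (fourierCoeff1 F n * (starRingEnd ℂ) (fourierCoeff1 G n))
      convert d3 using 2
      · simp only [D, zero_add, mul_zero, Complex.ofReal_zero, Complex.exp_zero]
        rw [div_eq_inv_mul, Complex.real_smul, Complex.ofReal_inv]
      · ring
    · filter_upwards [self_mem_nhdsWithin] with t ht n
      have ht : 0 < t := ht
      simp only [D]
      rw [norm_mul, norm_div, mul_assoc (n:ℂ), norm_mul (n:ℂ), ← mul_assoc]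
      gcongr
      rw [div_le_iff₀ (by simpa using ht.ne')]
      refine Real.norm_exp_I_mul_ofReal_sub_one_le.trans (le_of_eq ?_)
      rw [Complex.norm_intCast, Complex.norm_real, norm_mul, norm_mul, norm_mul]
      simp [abs_of_pos Real.pi_pos]
  have val : ∀ t, 0 < t → ∑' n, D t n =
      (((1 / t) * ∫ x in (0:ℝ)..1, (f (φ (x + t)) - f (φ x)) * g (φ x) : ℝ) : ℂ) := by
    intro t ht
    have cD : Continuous fun x => F (x + t) - F x := by fun_prop
    have pD : Function.Periodic (fun x => F (x + t) - F x) 1 := by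
      intro x
      have : x + 1 + t = (x + t) + 1 := by ring
      simp only [this, pF _]
    have h := ((qs_parseval _ _ cD cG pD pG).mul_left (1 / (t:ℂ))).tsum_eq
    push_cast
    rw [← intervalIntegral.integral_ofReal]
    convert h using 1
    · refine tsum_congr fun n => ?_
      rw [qs_coeff_diff F cF pF]
      simp only [D]; ring
    · congr 1
      apply intervalIntegral.integral_congr
      intro x _
      simp only [hF, hG, Function.comp, Complex.conj_ofReal]
      push_cast; ring
  have est : ∀ t, 0 < t → t ≤ 1 →
      |(1 / t) * (∫ x in (0:ℝ)..1, (f (φ (x + t)) - f (φ x)) * g (φ x)) - c| ≤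
        K * C * t ^ α := by
    intro t ht ht1
    have h1 := qs_int_shift (H ∘ φ) (cH.comp hc) c
      (fun x => by simp only [Function.comp, hl.2.2 x, pH]) t
    have h2 : |(∫ x in (0:ℝ)..1, (f (φ (x + t)) - f (φ x)) * g (φ x)) - c * t| ≤
        K * (C * t ^ α * t) := by
      rw [← h1, ← intervalIntegral.integral_sub]
      · calc _ ≤ ∫ x in (0:ℝ)..1, |(f (φ (x + t)) - f (φ x)) * g (φ x) -
                ((H ∘ φ) (x + t) - (H ∘ φ) x)| :=
              intervalIntegral.abs_integral_le_integral_abs (by norm_num)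
          _ ≤ ∫ x in (0:ℝ)..1, K * (φ (x + t) - φ x) ^ 2 := by
              apply intervalIntegral.integral_mono_on (by norm_num)
              · apply Continuous.intervalIntegrable; fun_prop
              · apply Continuous.intervalIntegrable; fun_prop
              · intro x _
                exact hK _ _ (hl.1.monotone (by linarith))
          _ = K * ∫ x in (0:ℝ)..1, (φ (x + t) - φ x) ^ 2 := by
              rw [intervalIntegral.integral_const_mul]
          _ ≤ _ := by
              gcongr
              exact qs_sq φ hl C α hC t ht ht1
      all_goals apply Continuous.intervalIntegrable; fun_prop
    have e : (1 / t) * (∫ x in (0:ℝ)..1, (f (φ (x + t)) - f (φ x)) * g (φ x)) - c =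
        ((∫ x in (0:ℝ)..1, (f (φ (x + t)) - f (φ x)) * g (φ x)) - c * t) / t := by
      field_simp
    rw [e, abs_div, abs_of_pos ht, div_le_iff₀ ht]
    linarith
  have lim2 : Tendsto (fun t => (1 / t) * ∫ x in (0:ℝ)..1, (f (φ (x + t)) - f (φ x)) * g (φ x))
      (𝓝[>] (0:ℝ)) (𝓝 c) := by
    rw [tendsto_iff_norm_sub_tendsto_zero]
    have z : Tendsto (fun t : ℝ => K * C * t ^ α) (𝓝[>] (0:ℝ)) (𝓝 0) := by
      have : Continuous fun t : ℝ => K * C * t ^ α :=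
        continuous_const.mul (Real.continuous_rpow_const α0.le)
      have := this.tendsto 0
      rw [Real.zero_rpow α0.ne', mul_zero] at this
      exact this.mono_left nhdsWithin_le_nhds
    refine squeeze_zero' (Eventually.of_forall fun t => norm_nonneg _) ?_ z
    filter_upwards [Ioc_mem_nhdsGT (one_pos : (0:ℝ) < 1)] with t ht
    exact est t ht.1 ht.2
  have lim3 := (Complex.continuous_ofReal.tendsto c).comp lim2
  rw [tsum_mul_left] at lim1
  refine tendsto_nhds_unique lim1 (lim3.congr' ?_)
  filter_upwards [self_mem_nhdsWithin] with t ht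
  exact (val t ht).symm

/-- **Quasisymmetric homeomorphisms act by symplectomorphisms on `H^{1/2}`.**
If `φ̃` is the lift of a quasisymmetric circle homeomorphism `φ` then, for all real
trigonometric polynomials `f, g` of period `1`, the series
`Σₙ n (f∘φ̃)^(n) conj((g∘φ̃)^(n))` converges absolutely and equals
`Σₙ n f̂(n) conj(ĝ(n))`; i.e. `Ω(f∘φ̃, g∘φ̃) = Ω(f, g)` for the symplectic form
`Ω(u,v) = −i Σₙ n uₙ conj(vₙ)`. -/
theorem quasisymmetric_symplectomorphism (φt : ℝ → ℝ) (hlift : IsCircleLift φt)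
    (hqs : ∃ M : ℝ, QSConst φt M)
    (f g : ℝ → ℝ) (hf : IsRealTrigPoly f) (hg : IsRealTrigPoly g) :
    Summable (fun n : ℤ => ‖(n : ℂ) * fourierCoeff1 (fun x => ((f ∘ φt) x : ℂ)) n *
      (starRingEnd ℂ) (fourierCoeff1 (fun x => ((g ∘ φt) x : ℂ)) n)‖) ∧
    ∑' n : ℤ, (n : ℂ) * fourierCoeff1 (fun x => ((f ∘ φt) x : ℂ)) n *
        (starRingEnd ℂ) (fourierCoeff1 (fun x => ((g ∘ φt) x : ℂ)) n) =
      ∑' n : ℤ, (n : ℂ) * fourierCoeff1 (fun x => (f x : ℂ)) n *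
        (starRingEnd ℂ) (fourierCoeff1 (fun x => (g x : ℂ)) n) := by
  obtain ⟨cf, pf⟩ := qs_trig f hf
  obtain ⟨cg, pg⟩ := qs_trig g hg
  have h1 := qs_main φt hlift hqs f g cf pf cg pg
  have hid : IsCircleLift id := ⟨strictMono_id, Function.surjective_id, fun _ => rfl⟩
  have hidq : ∃ M, QSConst id M := by
    refine ⟨1, one_pos, fun x t ht _ => ?_⟩
    have : (id (x + t) - id x) / (id x - id (x - t)) = 1 := by
      simp only [id]
      rw [add_sub_cancel_left, sub_sub_cancel, div_self ht.ne']
    rw [this]; norm_num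
  have h2 := qs_main id hid hidq f g cf pf cg pg
  refine ⟨h1.1, ?_⟩
  have h3 := h1.2.trans h2.2.symm
  exact mul_left_cancel₀ Complex.two_pi_I_ne_zero h3
end

section
/- A quasisymmetric homeomorphism preserves the Hardy splitting H = H₊ ⊕ H₋ if and only if it is a Möbius transformation: let φ̃ : ℝ → ℝ be an increasing homeomorphism with φ̃(x+1) = φ̃(x) + 1 whose induced circle homeomorphism φ is quasisymmetric. Then the following are equivalent: (i) for every n ≥ 1 and every m ≥ 1, the Fourier coefficient of index −m of the continuous 1-periodic function x ↦ e^{2πi n φ̃(x)} vanishes, i.e. ∫₀¹ e^{2πi n φ̃(x)} e^{2πimx} dx = 0; (ii) there exist a, b ∈ ℂ with |a|² − |b|² = 1 such that e^{2πi φ̃(x)} = (a e^{2πix} + b)/(b̄ e^{2πix} + ā) for all x ∈ ℝ, i.e. φ belongs to PSU(1,1). -/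
open Complex MeasureTheory

namespace HardyAux

abbrev CC := C(UnitAddCircle, ℂ)

theorem integrable_cc (f : CC) : Integrable f (AddCircle.haarAddCircle (T := 1)) :=
  f.continuous.integrable_of_hasCompactSupport (HasCompactSupport.of_compactSpace _)

theorem coeff_add (f g : CC) (n : ℤ) :
    fourierCoeff (f + g : CC) n = fourierCoeff f n + fourierCoeff g n := by
  have := congrFun (fourierCoeff.add (integrable_cc f) (integrable_cc g)) n
  simpa using this

theorem coeff_smul (c : ℂ) (f : CC) (n : ℤ) :
    fourierCoeff (c • f : CC) n = c * fourierCoeff f n := by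
  have := fourierCoeff.const_smul f c n
  simpa using this

theorem coeff_mul_fourier (f : CC) (k n : ℤ) :
    fourierCoeff (f * fourier k : CC) n = fourierCoeff f (n - k) := by
  unfold fourierCoeff
  congr 1
  ext t
  rw [show -(n - k) = -n + k by ring, fourier_add]
  simp only [ContinuousMap.mul_apply, smul_eq_mul]
  ring

theorem norm_coeff_le (f : CC) (n : ℤ) : ‖fourierCoeff f n‖ ≤ ‖f‖ := by
  unfold fourierCoeff
  refine (norm_integral_le_of_norm_le_const (C := ‖f‖) (Filter.Eventually.of_forall ?_)).trans ?_
  · intro t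
    rw [norm_smul, fourier_apply, Circle.norm_coe, one_mul]
    exact f.norm_coe_le_norm t
  · simp

noncomputable def coeffL (n : ℤ) : CC →L[ℂ] ℂ :=
  LinearMap.mkContinuous
    { toFun := fun f => fourierCoeff f n
      map_add' := fun f g => coeff_add f g n
      map_smul' := fun c f => coeff_smul c f n } 1
    (fun f => by simpa using norm_coeff_le f n)

@[simp] theorem coeffL_apply (n : ℤ) (f : CC) : coeffL n f = fourierCoeff f n := rfl

theorem coeff_star (f : CC) (n : ℤ) :
    fourierCoeff (star f : CC) n = (starRingEnd ℂ) (fourierCoeff f (-n)) := by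
  unfold fourierCoeff
  rw [← integral_conj]
  congr 1
  ext t
  simp only [smul_eq_mul, map_mul, neg_neg, fourier_neg, ContinuousMap.star_apply]
  rfl

theorem hasSum_coeff_mul (f h : CC) (k : ℤ) :
    HasSum (fun i : ℤ => fourierCoeff f (-i) * fourierCoeff h (k + i))
      (fourierCoeff (f * h : CC) k) := by
  have key := (fourierBasis (T := 1)).hasSum_inner_mul_inner
    (ContinuousMap.toLp 2 AddCircle.haarAddCircle ℂ (star f))
    (ContinuousMap.toLp 2 AddCircle.haarAddCircle ℂ (h * fourier (-k)))
  simp only [coe_fourierBasis, fourierLp, ContinuousMap.inner_toLp] at key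
  have e1 : ∀ i : ℤ, fourierCoeff f (-i) = ∫ x : AddCircle (1 : ℝ),
      (fourier i) x * (starRingEnd ℂ) ((star f : CC) x) ∂AddCircle.haarAddCircle := by
    intro i
    unfold fourierCoeff
    congr 1
    ext t
    simp
  have e2 : ∀ i : ℤ, fourierCoeff h (k + i) = ∫ x : AddCircle (1 : ℝ),
      (h * fourier (-k) : CC) x * (starRingEnd ℂ) ((fourier i) x) ∂AddCircle.haarAddCircle := by
    intro i
    have := coeff_mul_fourier h (-k) i
    rw [show k + i = i - -k by ring, ← this]
    unfold fourierCoeff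
    congr 1
    ext t
    rw [fourier_neg]
    simp only [smul_eq_mul]
    ring
  have e3 : fourierCoeff (f * h : CC) k = ∫ x : AddCircle (1 : ℝ),
      (h * fourier (-k) : CC) x * (starRingEnd ℂ) ((star f : CC) x) ∂AddCircle.haarAddCircle := by
    unfold fourierCoeff
    congr 1
    ext t
    simp only [smul_eq_mul, ContinuousMap.mul_apply, ContinuousMap.star_apply, RCLike.star_def,
      RCLike.conj_conj]
    ring
  simp only [e1, e2, e3]
  exact key

def IsHardy (f : CC) : Prop := ∀ n : ℤ, n < 0 → fourierCoeff f n = 0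

theorem IsHardy.mul {f h : CC} (hf : IsHardy f) (hh : IsHardy h) : IsHardy (f * h) := by
  intro k hk
  refine (hasSum_coeff_mul f h k).unique ?_
  convert hasSum_zero using 1
  ext i
  rcases lt_or_ge 0 i with h1 | h1
  · rw [hf _ (by omega), zero_mul]
  · rw [hh _ (by omega), mul_zero]

theorem IsHardy.coeff_zero_mul {f h : CC} (hf : IsHardy f) (hh : IsHardy h) :
    fourierCoeff (f * h : CC) 0 = fourierCoeff f 0 * fourierCoeff h 0 := by
  refine (hasSum_coeff_mul f h 0).unique ?_
  convert hasSum_single (0 : ℤ) ?_ using 1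
  · simp
  intro i hi
  rcases lt_or_ge 0 i with h1 | h1
  · rw [hf _ (by omega), zero_mul]
  · rw [hh _ (by omega), mul_zero]

theorem coeff_fourier_ne {k n : ℤ} (h : n ≠ k) : fourierCoeff (fourier k : CC) n = 0 := by
  rw [fourierCoeff_fourier]; simp [h]

theorem coeff_fourier_self (k : ℤ) : fourierCoeff (fourier k : CC) k = 1 := by
  rw [fourierCoeff_fourier]; simp

theorem fourier_zero_eq : (fourier 0 : CC) = 1 := by ext; simp

theorem isHardy_fourier {k : ℤ} (hk : 0 ≤ k) : IsHardy (fourier k) := fun n hn =>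
  coeff_fourier_ne (by omega)

noncomputable def hardy : Subalgebra ℂ CC where
  carrier := {f | IsHardy f}
  mul_mem' := fun hf hg => hf.mul hg
  add_mem' := fun {f g} hf hg n hn => by rw [coeff_add, hf n hn, hg n hn, add_zero]
  algebraMap_mem' := fun r n hn => by
    rw [Algebra.algebraMap_eq_smul_one, coeff_smul, ← fourier_zero_eq,
      coeff_fourier_ne (by omega), mul_zero]

theorem mem_hardy {f : CC} : f ∈ hardy ↔ IsHardy f := Iff.rfl

theorem isClosed_hardy : IsClosed (hardy : Set CC) := by
  have : (hardy : Set CC) = ⋂ n : ℤ, ⋂ _ : n < 0, (coeffL n) ⁻¹' {0} := by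
    ext f
    simp [mem_hardy, IsHardy]
  rw [this]
  exact isClosed_iInter fun n => isClosed_iInter fun _ =>
    isClosed_singleton.preimage (coeffL n).continuous

instance : CompleteSpace hardy := isClosed_hardy.completeSpace_coe

/-- Only zeroth coefficient nonzero implies constant. -/
theorem eq_const_of_coeff {f : CC} (h : ∀ n : ℤ, n ≠ 0 → fourierCoeff f n = 0) :
    ∀ x, f x = fourierCoeff f 0 := by
  have hs : Summable (fourierCoeff f) := summable_of_ne_finset_zero (s := {0}) (by
    intro n hn; exact h n (by simpa using hn))
  intro x
  refine (has_pointwise_sum_fourier_series_of_summable hs x).unique ?_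
  convert hasSum_single (0 : ℤ) ?_ using 1
  · simp
  · intro n hn
    rw [h n hn]; simp

/-- If `‖f‖ ≤ 1` and `‖c‖ < 1`, then `1 - c f` is invertible in the Hardy algebra. -/
theorem exists_inv {f : CC} (hf : IsHardy f) (h1 : ‖f‖ ≤ 1) {c : ℂ} (hc : ‖c‖ < 1) :
    ∃ g : CC, IsHardy g ∧ (1 - c • f) * g = 1 := by
  let F : hardy := ⟨c • f, hardy.smul_mem hf c⟩
  have hF : ‖F‖ < 1 := by
    change ‖c • f‖ < 1
    rw [norm_smul]
    exact lt_of_le_of_lt (mul_le_of_le_one_right (norm_nonneg _) h1) hc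
  let u := Units.oneSub F hF
  refine ⟨((u⁻¹ : (hardy)ˣ) : hardy), (((u⁻¹ : (hardy)ˣ) : hardy)).2, ?_⟩
  have := congrArg (Subtype.val) u.mul_inv
  simpa [u, F] using this

/-- Boundary version: if `‖c‖ ≤ 1` and `1 - c f` vanishes nowhere. -/
theorem exists_inv' {f : CC} (hf : IsHardy f) (h1 : ‖f‖ ≤ 1) {c : ℂ} (hc : ‖c‖ ≤ 1)
    (hne : ∀ x, 1 - c * f x ≠ 0) :
    ∃ g : CC, IsHardy g ∧ (1 - c • f) * g = 1 := by
  let F : hardy := ⟨f, hf⟩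
  let P : ℝ → hardy := fun r => 1 - ((r : ℂ) * c) • F
  have hP : Continuous P := by
    have : Continuous fun r : ℝ => (1 : CC) - ((r : ℂ) * c) • f := by fun_prop
    exact this.subtype_mk (fun r => (P r).2)
  have : IsClosed (hardy : Set CC) := isClosed_hardy
  have hunit : IsUnit (P 1) := by
    refine Subalgebra.isUnit_of_isUnit_val_of_eventually hardy (l := Filter.map P (nhdsWithin 1 (Set.Ioo 0 1))) ?_ ?_ ?_ ?_
    · rw [ContinuousMap.isUnit_iff_forall_ne_zero]
      intro x
      simpa [P, F] using hne x
    · exact (hP.tendsto 1).mono_left nhdsWithin_le_nhds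
    · rw [Filter.eventually_map]
      filter_upwards [self_mem_nhdsWithin] with r hr
      have hF : ‖((r : ℂ) * c) • F‖ < 1 := by
        change ‖((r : ℂ) * c) • f‖ < 1
        rw [norm_smul]
        have h3 : ‖(r : ℂ) * c‖ < 1 := by
          rw [norm_mul, Complex.norm_real, Real.norm_of_nonneg hr.1.le]
          nlinarith [hr.1, hr.2, norm_nonneg c]
        exact lt_of_le_of_lt (mul_le_of_le_one_right (norm_nonneg _) h1) h3
      exact (Units.oneSub _ hF).isUnit
    · have : (nhdsWithin (1:ℝ) (Set.Ioo 0 1)).NeBot := by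
        rw [← mem_closure_iff_nhdsWithin_neBot, closure_Ioo (by norm_num)]
        simp
      exact this.map P
  obtain ⟨u, hu⟩ := hunit
  refine ⟨((u⁻¹ : (hardy)ˣ) : hardy), (((u⁻¹ : (hardy)ˣ) : hardy)).2, ?_⟩
  have := congrArg (Subtype.val) u.mul_inv
  rw [hu] at this
  simpa [P, F] using this

theorem norm_le_one_of_unimodular {f : CC} (h : ∀ x, ‖f x‖ = 1) : ‖f‖ ≤ 1 :=
  (ContinuousMap.norm_le _ zero_le_one).2 fun x => (h x).le

theorem conj_eq_of_unimodular {z : ℂ} (h : ‖z‖ = 1) : z * (starRingEnd ℂ) z = 1 := by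
  rw [Complex.mul_conj, Complex.normSq_eq_norm_sq, h]; simp

theorem const_of_omit {H : CC} (hH : IsHardy H) (hu : ∀ x, ‖H x‖ = 1) {c : ℂ} (hc : ‖c‖ = 1)
    (hne : ∀ x, 1 - c * H x ≠ 0) (x y : UnitAddCircle) : H x = H y := by
  obtain ⟨K, hK, hK1⟩ := exists_inv' hH (norm_le_one_of_unimodular hu) hc.le hne
  have hp : ∀ x, (1 - c * H x) * K x = 1 := fun x => by
    simpa using congrArg (fun f : CC => f x) hK1
  have hc1 := conj_eq_of_unimodular hc
  have hs : star K + K = 1 := by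
    ext x
    have h1 := hp x
    have h2 := congrArg (starRingEnd ℂ) h1
    have h3 := conj_eq_of_unimodular (hu x)
    simp only [map_mul, map_sub, map_one] at h2
    simp only [ContinuousMap.add_apply, ContinuousMap.star_apply, ContinuousMap.one_apply,
      RCLike.star_def]
    have hne' : (1 - (starRingEnd ℂ) c * (starRingEnd ℂ) (H x)) ≠ 0 := left_ne_zero_of_mul_eq_one h2
    apply mul_left_cancel₀ (mul_ne_zero (hne x) hne')
    have h4 : (c * H x) * ((starRingEnd ℂ) c * (starRingEnd ℂ) (H x)) = 1 := by
      linear_combination hc1 + (c * (starRingEnd ℂ) c) * h3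
    linear_combination (1 - c * H x) * h2 +
      (1 - (starRingEnd ℂ) c * (starRingEnd ℂ) (H x)) * h1 - h4
  have hcoef : ∀ n : ℤ, n ≠ 0 → fourierCoeff K n = 0 := by
    intro n hn
    rcases lt_or_gt_of_ne hn with h | h
    · exact hK n h
    · have h1 := coeff_add (star K) K (-n)
      rw [hs, ← fourier_zero_eq, coeff_fourier_ne (by omega), coeff_star, neg_neg,
        hK (-n) (by omega), add_zero] at h1
      simpa using h1.symm
  have hxy : K x = K y := by
    rw [eq_const_of_coeff hcoef x, eq_const_of_coeff hcoef y]
  have hc0 : c ≠ 0 := by rintro rfl; simp at hc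
  have hKy : K y ≠ 0 := right_ne_zero_of_mul_eq_one (hp y)
  have h1 := hp x
  have h2 := hp y
  rw [hxy] at h1
  apply mul_left_cancel₀ (mul_ne_zero hc0 hKy)
  linear_combination h2 - h1

theorem norm_coeff_zero_lt {g : CC} (hu : ∀ x, ‖g x‖ = 1) (hnc : ∃ x y, g x ≠ g y) :
    ‖fourierCoeff g 0‖ < 1 := by
  by_contra hcon
  push Not at hcon
  have h := hasSum_coeff_mul (star g) g 0
  have h1 : star g * g = 1 := by
    ext x
    simpa [mul_comm] using conj_eq_of_unimodular (hu x)
  rw [h1, ← fourier_zero_eq, coeff_fourier_self] at h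
  have h2 : HasSum (fun i : ℤ => ‖fourierCoeff g i‖ ^ 2) 1 := by
    rw [← Complex.hasSum_ofReal]
    convert h using 1
    · ext i
      rw [coeff_star, neg_neg, zero_add, mul_comm, Complex.mul_conj, Complex.normSq_eq_norm_sq]
    · simp
  have h3 : ∀ n : ℤ, n ≠ 0 → fourierCoeff g n = 0 := by
    intro n hn
    have h4 := sum_le_hasSum ({0, n} : Finset ℤ) (fun i _ => sq_nonneg _) h2
    rw [Finset.sum_pair hn.symm] at h4
    have h5 : ‖fourierCoeff g n‖ ^ 2 ≤ 0 := by nlinarith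
    have h6 : ‖fourierCoeff g n‖ = 0 := by
      have := sq_nonneg ‖fourierCoeff g n‖
      exact pow_eq_zero_iff (two_ne_zero) |>.1 (le_antisymm h5 this)
    simpa using h6
  obtain ⟨x, y, hxy⟩ := hnc
  exact hxy (by rw [eq_const_of_coeff h3 x, eq_const_of_coeff h3 y])

theorem exists_quotient {g : CC} (hg : IsHardy g) (hu : ∀ x, ‖g x‖ = 1)
    (ha : ‖fourierCoeff g 0‖ < 1) :
    ∃ H : CC, IsHardy H ∧ ∀ x, H x * fourier 1 x *
      (1 - (starRingEnd ℂ) (fourierCoeff g 0) * g x) = g x - fourierCoeff g 0 := by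
  set a := fourierCoeff g 0 with ha'
  obtain ⟨K, hK, hK1⟩ := exists_inv hg (norm_le_one_of_unimodular hu)
    (c := (starRingEnd ℂ) a) (by simpa using ha)
  have hp : ∀ x, (1 - (starRingEnd ℂ) a * g x) * K x = 1 := fun x => by
    simpa using congrArg (fun f : CC => f x) hK1
  have hd : IsHardy (g + (-a) • (1 : CC)) :=
    hardy.add_mem hg (hardy.smul_mem hardy.one_mem _)
  have hG : IsHardy ((g + (-a) • (1 : CC)) * K) := hd.mul hK
  have hG0 : fourierCoeff ((g + (-a) • (1 : CC)) * K : CC) 0 = 0 := by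
    rw [hd.coeff_zero_mul hK, coeff_add, coeff_smul, ← fourier_zero_eq, coeff_fourier_self, ← ha']
    ring
  refine ⟨(g + (-a) • (1 : CC)) * K * fourier (-1), ?_, ?_⟩
  · intro n hn
    rw [coeff_mul_fourier]
    rcases eq_or_ne n (-1) with rfl | h
    · simpa using hG0
    · exact hG _ (by omega)
  · intro x
    have h1 : fourier (-1) x * fourier 1 x = (1 : ℂ) := by
      rw [← fourier_add]; simp
    simp only [ContinuousMap.mul_apply, ContinuousMap.add_apply, ContinuousMap.smul_apply,
      ContinuousMap.one_apply, smul_eq_mul]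
    linear_combination (g x - a) * (fourier (-1) x * fourier 1 x) * hp x + (g x - a) * h1

theorem exists_cc {F : ℝ → ℂ} (hF : Continuous F) (hp : Function.Periodic F 1) :
    ∃ g : CC, ∀ x : ℝ, g (x : UnitAddCircle) = F x :=
  ⟨⟨hp.lift, continuous_coinduced_dom.mpr hF⟩, fun _ => rfl⟩

theorem fourier_coe_one (n : ℤ) (x : ℝ) :
    (fourier n (x : UnitAddCircle) : ℂ) = Complex.exp (2 * Real.pi * Complex.I * n * x) := by
  rw [fourier_coe_apply]; simp

theorem coeff_neg_eq {F : ℝ → ℂ} {g : CC} (h : ∀ x : ℝ, g (x : UnitAddCircle) = F x) (m : ℤ) :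
    fourierCoeff g (-m) =
      ∫ x in (0 : ℝ)..1, F x * Complex.exp (2 * Real.pi * Complex.I * m * x) := by
  rw [fourierCoeff_eq_intervalIntegral _ _ 0]
  simp only [neg_neg, fourier_coe_one, h, smul_eq_mul, zero_add]
  simp [mul_comm]

/-- The periodic part of the lift omits a value. -/
theorem exists_omit {ψ : ℝ → ℝ} (hc : Continuous ψ) (hinj : Function.Injective ψ)
    (hp : ∀ x, ψ (x + 1) = ψ x + 1) :
    ∃ c : ℝ, ∀ x : ℝ, ∀ k : ℤ, ψ x - x - c ≠ k := by
  have hmono : StrictMono ψ := by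
    rcases hc.strictMono_of_inj hinj with h | h
    · exact h
    · have := h (show (0 : ℝ) < 0 + 1 by norm_num)
      rw [hp] at this
      linarith
  have hper : Function.Periodic (fun x => ψ x - x) 1 := fun x => by
    simp only [hp]; ring
  have hcu : Continuous (fun x => ψ x - x) := by fun_prop
  obtain ⟨p, hpI, hpm⟩ := isCompact_Icc.exists_isMinOn (s := Set.Icc (0 : ℝ) 1) ⟨0, by simp⟩
    hcu.continuousOn
  obtain ⟨q, hqI, hqm⟩ := isCompact_Icc.exists_isMaxOn (s := Set.Icc (0 : ℝ) 1) ⟨0, by simp⟩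
    hcu.continuousOn
  have hall : ∀ x, ψ p - p ≤ ψ x - x ∧ ψ x - x ≤ ψ q - q := by
    intro x
    obtain ⟨y, hy, hxy⟩ := hper.exists_mem_Ico₀ one_pos x
    have hy' : y ∈ Set.Icc (0 : ℝ) 1 := ⟨hy.1, hy.2.le⟩
    have h1 := hpm hy'
    have h2 := hqm hy'
    simp only [Set.mem_ofPred_eq] at h1 h2 hxy
    rw [hxy]
    exact ⟨h1, h2⟩
  have hosc : (ψ q - q) - (ψ p - p) < 1 := by
    rcases le_total p q with h | h
    · rcases eq_or_lt_of_le h with rfl | h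
      · simp
      · have h1 : ψ q ≤ ψ p + 1 := by
          rw [← hp]; exact hmono.monotone (by linarith [hpI.1, hqI.2])
        linarith
    · rcases eq_or_lt_of_le h with rfl | h
      · simp
      · have h1 : ψ q < ψ p := hmono h
        have : p - q ≤ 1 := by linarith [hpI.2, hqI.1]
        linarith
  refine ⟨((ψ q - q) + (ψ p - p)) / 2 + 1 / 2, fun x k hk => ?_⟩
  obtain ⟨h1, h2⟩ := hall x
  have h3 : (k : ℝ) < 0 := by rw [← hk]; linarith
  have h4 : (-1 : ℝ) < k := by rw [← hk]; linarith
  have h5 : k < 0 := by exact_mod_cast h3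
  have h6 : -1 < k := by exact_mod_cast h4
  omega

theorem exp_eq_iff {x y : ℝ} : Complex.exp (2 * Real.pi * Complex.I * x) =
    Complex.exp (2 * Real.pi * Complex.I * y) ↔ ∃ k : ℤ, x - y = k := by
  rw [Complex.exp_eq_exp_iff_exists_int]
  refine exists_congr fun k => ?_
  have h0 : (2 * Real.pi * Complex.I : ℂ) ≠ 0 := Complex.two_pi_I_ne_zero
  constructor
  · intro h
    have : ((x - y : ℝ) : ℂ) = ((k : ℝ) : ℂ) := by
      push_cast
      apply mul_left_cancel₀ h0
      linear_combination h
    exact_mod_cast this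
  · intro h
    have : ((x - y : ℝ) : ℂ) = ((k : ℝ) : ℂ) := by rw [h]
    push_cast at this
    linear_combination (2 * Real.pi * Complex.I : ℂ) * this

theorem norm_exp_one (x : ℝ) : ‖Complex.exp (2 * Real.pi * Complex.I * x)‖ = 1 := by
  have := Complex.norm_exp_ofReal_mul_I (2 * Real.pi * x)
  rw [← this]; congr 2; push_cast; ring

theorem exp_neg_two_arg (v : ℂ) :
    Complex.exp (-(2 * Complex.I * (Complex.arg v : ℂ))) * v = (starRingEnd ℂ) v := by
  have h1 := Complex.norm_mul_exp_arg_mul_I v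
  have h2 : Complex.exp (-(Complex.arg v * Complex.I)) * Complex.exp (Complex.arg v * Complex.I) = 1 := by
    rw [← Complex.exp_add]; simp
  have h3 : (starRingEnd ℂ) v = ‖v‖ * Complex.exp (-(Complex.arg v * Complex.I)) := by
    conv_lhs => rw [← h1]
    rw [map_mul, Complex.conj_ofReal, ← Complex.exp_conj]
    simp
  rw [h3, show -(2 * Complex.I * (Complex.arg v : ℂ)) = -(Complex.arg v * Complex.I) + -(Complex.arg v * Complex.I) by ring,
    Complex.exp_add]
  linear_combination (-Complex.exp (-(Complex.arg v * Complex.I)) ^ 2) * h1 +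
    ‖v‖ * Complex.exp (-(Complex.arg v * Complex.I)) * h2

theorem lift_int {f : ℝ → ℝ} (h : ∀ x, f (x + 1) = f x + 1) (k : ℤ) (x : ℝ) :
    f (x + k) = f x + k := by
  have hper : Function.Periodic (fun x => f x - x) 1 := fun x => by
    simp only [h]; ring
  have := hper.int_mul k x
  simp only [mul_one] at this
  linarith

theorem one_add_ne_zero {z : ℂ} (h : ‖z‖ < 1) : 1 + z ≠ 0 := by
  intro h0
  have : z = -1 := by linear_combination h0
  rw [this] at h
  simp at h

theorem exp_periodic {f : ℝ → ℝ} (h : ∀ x, f (x + 1) = f x + 1) (x : ℝ) :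
    Complex.exp (2 * Real.pi * Complex.I * f (x + 1)) =
      Complex.exp (2 * Real.pi * Complex.I * f x) :=
  exp_eq_iff.2 ⟨1, by rw [h]; simp⟩

theorem forward {φt : ℝ → ℝ} (hlift : IsCircleLift φt)
    (h : ∀ m : ℤ, 1 ≤ m → (∫ x in (0 : ℝ)..1, Complex.exp (2 * Real.pi * Complex.I * φt x) *
        Complex.exp (2 * Real.pi * Complex.I * m * x)) = 0) :
    ∃ a b : ℂ, ‖a‖ ^ 2 - ‖b‖ ^ 2 = 1 ∧
      ∀ x : ℝ, Complex.exp (2 * Real.pi * Complex.I * φt x) =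
        (a * Complex.exp (2 * Real.pi * Complex.I * x) + b) /
          ((starRingEnd ℂ) b * Complex.exp (2 * Real.pi * Complex.I * x) +
            (starRingEnd ℂ) a) := by
  obtain ⟨hmono, hsurj, hper⟩ := hlift
  have hcont : Continuous φt := hmono.monotone.continuous_of_surjective hsurj
  obtain ⟨g, hgF⟩ := exists_cc (F := fun x => Complex.exp (2 * Real.pi * Complex.I * φt x))
    (by fun_prop) (fun x => exp_periodic hper x)
  have hg : IsHardy g := by
    intro n hn
    have := coeff_neg_eq hgF (-n)
    rw [neg_neg] at this
    rw [this]
    exact h (-n) (by omega)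
  have hu : ∀ x, ‖g x‖ = 1 := by
    intro x
    induction x using QuotientAddGroup.induction_on with
    | H x => rw [hgF]; exact norm_exp_one _
  have hnc : ∃ x y, g x ≠ g y := by
    obtain ⟨y, hy⟩ := hsurj (φt 0 + 1 / 2)
    refine ⟨((y : ℝ) : UnitAddCircle), ((0 : ℝ) : UnitAddCircle), ?_⟩
    rw [hgF, hgF]
    intro he
    obtain ⟨k, hk⟩ := exp_eq_iff.1 he
    rw [hy] at hk
    have h2 : (2 * k : ℝ) = 1 := by linarith
    have h3 : 2 * k = 1 := by exact_mod_cast h2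
    omega
  have ha := norm_coeff_zero_lt hu hnc
  obtain ⟨H, hH, hHeq⟩ := exists_quotient hg hu ha
  set a := fourierCoeff g 0 with ha'
  have hca : ‖(starRingEnd ℂ) a‖ < 1 := by simpa using ha
  -- the lift of the normalised map
  let v : ℝ → ℂ := fun x => 1 - (starRingEnd ℂ) a * g (x : UnitAddCircle)
  have hlt : ∀ x : UnitAddCircle, ‖(starRingEnd ℂ) a * g x‖ < 1 := fun x => by
    rw [norm_mul, hu, mul_one]; exact hca
  have hvre : ∀ x, 0 < (v x).re := by
    intro x
    have := (Complex.re_le_norm ((starRingEnd ℂ) a * g (x : UnitAddCircle))).trans_lt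
      (hlt (x : UnitAddCircle))
    simp only [v, Complex.sub_re, Complex.one_re]
    linarith
  have hv0 : ∀ x, v x ≠ 0 := fun x h0 => by
    have := hvre x
    rw [h0] at this
    simp at this
  have hgc : Continuous fun x : ℝ => g (x : UnitAddCircle) :=
    g.continuous.comp (AddCircle.continuous_mk' 1)
  have hvc : Continuous v := by
    simp only [v]
    exact continuous_const.sub (continuous_const.mul hgc)
  let ψ : ℝ → ℝ := fun x => φt x - Complex.arg (v x) / Real.pi
  have hψc : Continuous ψ := by
    refine hcont.sub (Continuous.div_const ?_ _)
    rw [continuous_iff_continuousAt]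
    intro x
    exact (Complex.continuousAt_arg (Or.inl (hvre x))).comp hvc.continuousAt
  have hvp : ∀ x, v (x + 1) = v x := by
    intro x
    simp only [v, hgF, exp_periodic hper]
  have hψp : ∀ x, ψ (x + 1) = ψ x + 1 := by
    intro x
    simp only [ψ, hvp, hper]
    ring
  have hE : ∀ x, Complex.exp (2 * Real.pi * Complex.I * ψ x) * v x
      = g (x : UnitAddCircle) - a := by
    intro x
    have hpi : (Real.pi : ℂ) ≠ 0 := by exact_mod_cast Real.pi_ne_zero
    have h1 : (2 * Real.pi * Complex.I * ψ x : ℂ) =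
        2 * Real.pi * Complex.I * φt x + -(2 * Complex.I * (Complex.arg (v x) : ℂ)) := by
      simp only [ψ]
      push_cast
      field_simp
      ring
    rw [h1, Complex.exp_add, mul_assoc, exp_neg_two_arg, ← hgF]
    simp only [v, map_sub, map_one, map_mul, Complex.conj_conj]
    linear_combination (-a) * conj_eq_of_unimodular (hu (x : UnitAddCircle))
  have hψinj : Function.Injective ψ := by
    intro x y hxy
    have h1 := hE x
    have h2 := hE y
    rw [hxy] at h1
    set E := Complex.exp (2 * Real.pi * Complex.I * ψ y) with hEd
    have hne : 1 + E * (starRingEnd ℂ) a ≠ 0 := by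
      apply one_add_ne_zero
      rw [norm_mul, hEd, norm_exp_one, one_mul]; exact hca
    have h3 : g (x : UnitAddCircle) = g (y : UnitAddCircle) := by
      apply mul_left_cancel₀ hne
      simp only [v] at h1 h2
      linear_combination h2 - h1
    rw [hgF, hgF] at h3
    obtain ⟨k, hk⟩ := exp_eq_iff.1 h3
    have h4 : x = y + k := by
      apply hmono.injective
      rw [lift_int hper]; linarith
    rw [h4, lift_int hψp] at hxy
    have : (k : ℝ) = 0 := by linarith
    rw [h4, this, add_zero]
  obtain ⟨c, hc⟩ := exists_omit hψc hψinj hψp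
  have hHe : ∀ x : ℝ, H (x : UnitAddCircle) =
      Complex.exp (2 * Real.pi * Complex.I * ((ψ x - x : ℝ) : ℂ)) := by
    intro x
    have h1 := hHeq (x : UnitAddCircle)
    rw [← hE x, fourier_coe_one] at h1
    have h2 := mul_right_cancel₀ (hv0 x) h1
    have h3 : Complex.exp (2 * Real.pi * Complex.I * ψ x) =
        Complex.exp (2 * Real.pi * Complex.I * ((ψ x - x : ℝ) : ℂ)) *
          Complex.exp (2 * Real.pi * Complex.I * (1 : ℤ) * x) := by
      rw [← Complex.exp_add]; congr 1; push_cast; ring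
    rw [h3] at h2
    exact mul_right_cancel₀ (Complex.exp_ne_zero _) h2
  have hHu : ∀ x, ‖H x‖ = 1 := by
    intro x
    induction x using QuotientAddGroup.induction_on with
    | H x => rw [hHe]; exact norm_exp_one _
  have hconst := const_of_omit hH hHu (c := Complex.exp (2 * Real.pi * Complex.I * ((-c : ℝ) : ℂ)))
    (norm_exp_one _) (by
      intro x
      induction x using QuotientAddGroup.induction_on with
      | H x =>
        rw [hHe, ← Complex.exp_add]
        intro h0
        have h1 : Complex.exp (2 * Real.pi * Complex.I * ((ψ x - x - c : ℝ) : ℂ)) =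
            Complex.exp (2 * Real.pi * Complex.I * ((0 : ℝ) : ℂ)) := by
          rw [Complex.ofReal_zero, mul_zero, Complex.exp_zero, ← sub_eq_zero, ← neg_eq_zero, ← h0,
            neg_sub]
          congr 2
          push_cast
          ring
        obtain ⟨k, hk⟩ := exp_eq_iff.1 h1
        exact hc x k (by rw [← hk]; ring))
  -- final normalisation
  obtain ⟨t, ht⟩ : ∃ t : ℝ, t = ψ 0 - 0 := ⟨_, rfl⟩
  set ρ : ℂ := Complex.exp (2 * Real.pi * Complex.I * ((t / 2 : ℝ) : ℂ)) with hρ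
  have hρu : ‖ρ‖ = 1 := norm_exp_one _
  have hκ : ∀ x, H x = ρ * ρ := by
    intro x
    rw [hconst x ((0 : ℝ) : UnitAddCircle), hHe, hρ, ← Complex.exp_add, ← ht]
    congr 1
    push_cast
    ring
  have hρ1 := conj_eq_of_unimodular hρu
  have hpos : 0 < 1 - ‖a‖ ^ 2 := by nlinarith [norm_nonneg a]
  set s : ℝ := (Real.sqrt (1 - ‖a‖ ^ 2))⁻¹ with hs
  have hspos : 0 < s := inv_pos.2 (Real.sqrt_pos.2 hpos)
  have hs2 : s ^ 2 * (1 - ‖a‖ ^ 2) = 1 := by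
    rw [hs, inv_pow, Real.sq_sqrt hpos.le]
    exact inv_mul_cancel₀ hpos.ne'
  refine ⟨s * ρ, s * a * (starRingEnd ℂ) ρ, ?_, ?_⟩
  · simp only [norm_mul, Complex.norm_real, Real.norm_of_nonneg hspos.le, hρu, RCLike.norm_conj,
      mul_one]
    linear_combination hs2
  · intro x
    have h1 := hHeq (x : UnitAddCircle)
    rw [hκ, fourier_coe_one, hgF] at h1
    simp only [Int.cast_one, mul_one] at h1
    simp only [map_mul, Complex.conj_ofReal, Complex.conj_conj]
    set e := Complex.exp (2 * Real.pi * Complex.I * x) with he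
    set G := Complex.exp (2 * Real.pi * Complex.I * φt x)
    have hs0 : (s : ℂ) ≠ 0 := by exact_mod_cast hspos.ne'
    have hρ0 : (starRingEnd ℂ) ρ ≠ 0 := right_ne_zero_of_mul_eq_one hρ1
    have hden : 1 + ρ * ρ * e * (starRingEnd ℂ) a ≠ 0 := by
      apply one_add_ne_zero
      rw [norm_mul, norm_mul, norm_mul, hρu, he, norm_exp_one]
      simpa using ha
    have hden' : (s : ℂ) * (starRingEnd ℂ) a * ρ * e + s * (starRingEnd ℂ) ρ ≠ 0 := by
      have : (s : ℂ) * (starRingEnd ℂ) a * ρ * e + s * (starRingEnd ℂ) ρ =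
          s * (starRingEnd ℂ) ρ * (1 + ρ * ρ * e * (starRingEnd ℂ) a) := by
        linear_combination (-(s : ℂ) * (starRingEnd ℂ) a * ρ * e) * hρ1
      rw [this]
      exact mul_ne_zero (mul_ne_zero hs0 hρ0) hden
    rw [eq_div_iff hden']
    linear_combination (-(s : ℂ) * (starRingEnd ℂ) ρ) * h1 +
      (s * ρ * e - s * ρ * e * (starRingEnd ℂ) a * G) * hρ1

theorem backward {φt : ℝ → ℝ}
    (h : ∃ a b : ℂ, ‖a‖ ^ 2 - ‖b‖ ^ 2 = 1 ∧
      ∀ x : ℝ, Complex.exp (2 * Real.pi * Complex.I * φt x) =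
        (a * Complex.exp (2 * Real.pi * Complex.I * x) + b) /
          ((starRingEnd ℂ) b * Complex.exp (2 * Real.pi * Complex.I * x) +
            (starRingEnd ℂ) a)) :
    ∀ n m : ℤ, 1 ≤ n → 1 ≤ m →
      (∫ x in (0 : ℝ)..1, Complex.exp (2 * Real.pi * Complex.I * n * φt x) *
        Complex.exp (2 * Real.pi * Complex.I * m * x)) = 0 := by
  obtain ⟨a, b, hab, hx⟩ := h
  have ha0 : a ≠ 0 := by
    rintro rfl
    simp at hab
    nlinarith [sq_nonneg ‖b‖]
  have hca0 : (starRingEnd ℂ) a ≠ 0 := by simpa using ha0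
  have hlt : ‖-((starRingEnd ℂ) b / (starRingEnd ℂ) a)‖ < 1 := by
    rw [norm_neg, norm_div, RCLike.norm_conj, RCLike.norm_conj, div_lt_one (norm_pos_iff.2 ha0)]
    nlinarith [norm_nonneg a, norm_nonneg b]
  obtain ⟨K, hK, hK1⟩ := exists_inv (isHardy_fourier zero_le_one) (fourier_norm 1).le hlt
  have hp : ∀ x, (1 - -((starRingEnd ℂ) b / (starRingEnd ℂ) a) * fourier 1 x) * K x = 1 :=
    fun x => by
      have := congrArg (fun f : CC => f x) hK1
      simpa only [ContinuousMap.mul_apply, ContinuousMap.sub_apply, ContinuousMap.smul_apply,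
        ContinuousMap.one_apply, smul_eq_mul] using this
  let g : CC := ((starRingEnd ℂ) a)⁻¹ • ((a • fourier 1 + b • (1 : CC)) * K)
  have hg : g ∈ hardy := hardy.smul_mem (hardy.mul_mem (hardy.add_mem
    (hardy.smul_mem (isHardy_fourier zero_le_one) _) (hardy.smul_mem hardy.one_mem _)) hK) _
  have hgF : ∀ x : ℝ, g (x : UnitAddCircle) = Complex.exp (2 * Real.pi * Complex.I * φt x) := by
    intro x
    have h1 := hp (x : UnitAddCircle)
    rw [hx]
    simp only [g, ContinuousMap.mul_apply, ContinuousMap.add_apply, ContinuousMap.smul_apply,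
        ContinuousMap.one_apply, smul_eq_mul]
    rw [fourier_coe_one] at h1 ⊢
    simp only [Int.cast_one, mul_one] at h1 ⊢
    set e := Complex.exp (2 * Real.pi * Complex.I * x)
    have h2 : ((starRingEnd ℂ) b * e + (starRingEnd ℂ) a) * (((starRingEnd ℂ) a)⁻¹ * K x) = 1 := by
      rw [← h1]
      field_simp
      ring
    rw [eq_div_iff (left_ne_zero_of_mul_eq_one h2)]
    linear_combination (a * e + b) * h2
  intro n m hn hm
  obtain ⟨N, rfl⟩ := Int.eq_ofNat_of_zero_le (show 0 ≤ n by omega)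
  have hgn : IsHardy (g ^ N) := hardy.pow_mem hg N
  have hgnF : ∀ x : ℝ, (g ^ N) (x : UnitAddCircle) =
      Complex.exp (2 * Real.pi * Complex.I * ((N : ℤ) : ℂ) * φt x) := by
    intro x
    rw [ContinuousMap.pow_apply, hgF, ← Complex.exp_nat_mul]
    congr 1
    push_cast
    ring
  rw [← coeff_neg_eq (F := fun x => Complex.exp (2 * Real.pi * Complex.I * ((N : ℤ) : ℂ) * φt x))
    hgnF m]
  exact hgn (-m) (by omega)

end HardyAux

/-- **A quasisymmetric homeomorphism preserves the Hardy splitting `H = H₊ ⊕ H₋` iff it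
is a Möbius transformation.**  Let `φ̃` be the lift of a quasisymmetric circle
homeomorphism `φ`.  The following are equivalent: (i) for all `n, m ≥ 1` the Fourier
coefficient of index `−m` of `x ↦ e^{2πinφ̃(x)}` vanishes, i.e.
`∫₀¹ e^{2πinφ̃(x)} e^{2πimx} dx = 0`; (ii) there are `a, b ∈ ℂ` with `|a|² − |b|² = 1` and
`e^{2πiφ̃(x)} = (a e^{2πix} + b)/(b̄ e^{2πix} + ā)` for all `x`, i.e. `φ ∈ PSU(1,1)`. -/
theorem preserves_hardy_splitting_iff_moebius (φt : ℝ → ℝ) (hlift : IsCircleLift φt)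
    (hqs : ∃ M : ℝ, QSConst φt M) :
    (∀ n m : ℤ, 1 ≤ n → 1 ≤ m →
      (∫ x in (0 : ℝ)..1, Complex.exp (2 * Real.pi * Complex.I * n * φt x) *
        Complex.exp (2 * Real.pi * Complex.I * m * x)) = 0) ↔
    (∃ a b : ℂ, ‖a‖ ^ 2 - ‖b‖ ^ 2 = 1 ∧
      ∀ x : ℝ, Complex.exp (2 * Real.pi * Complex.I * φt x) =
        (a * Complex.exp (2 * Real.pi * Complex.I * x) + b) /
          ((starRingEnd ℂ) b * Complex.exp (2 * Real.pi * Complex.I * x) +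
            (starRingEnd ℂ) a)) := by
  constructor
  · intro h
    exact HardyAux.forward hlift (fun m hm => by simpa using h 1 m le_rfl hm)
  · exact HardyAux.backward
end
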